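/- For an integer p ≥ 2 let K(p) = {k ≥ 1 : Σ_k^p = 2π⌊(k+1)/2⌋} (the set of indices for which the disk's normalized eigenvalue equals the supremum over the p-fold symmetric class). Then: (i) if p is even, p ∉ K(p); (ii) if 2 ≤ p ≤ 6, then K(p) ∩ [p+1, ∞) = ∅; (iii) if p is odd, then K(p) ∩ [2p, ∞) = ∅; (iv) if p is even, then K(p) ∩ [2p, ∞) ⊆ {3p−1}. (Corollary 4.5 of the paper.) -/

import Mathlib

open Set MeasureTheory Metric Filter Asymptotics
open scoped ENNReal Topology NNReal

noncomputable section

abbrev E2 : Type := EuclideanSpace ℝ (Fin 2)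

def IsLipschitzDomain (Ω : Set E2) : Prop :=
  IsOpen Ω ∧ IsConnected Ω ∧ Bornology.IsBounded Ω ∧
    ∀ p ∈ frontier Ω, ∃ (e : E2 ≃ₗᵢ[ℝ] E2) (K : ℝ≥0) (φ : ℝ → ℝ) (U : Set E2),
      LipschitzWith K φ ∧ IsOpen U ∧ p ∈ U ∧
      ∀ x ∈ U, (x ∈ Ω ↔ φ (e x 0) < e x 1)

def dirEnergy (Ω : Set E2) (f : E2 → ℝ) : ℝ≥0∞ :=
  ∫⁻ x in Ω, (‖fderiv ℝ f x‖₊ : ℝ≥0∞) ^ 2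

def bdryInt (Γ : Set E2) (ρ f : E2 → ℝ) : ℝ≥0∞ :=
  ∫⁻ x in Γ, ENNReal.ofReal (ρ x * (f x) ^ 2) ∂μH[1]

def rayleigh (Ω Γ : Set E2) (ρ f : E2 → ℝ) : ℝ≥0∞ :=
  dirEnergy Ω f / bdryInt Γ ρ f

def steklovMixed (Ω ΓS ΓD : Set E2) (ρ : E2 → ℝ) (k : ℕ) : ℝ≥0∞ :=
  ⨅ (V : Submodule ℝ (E2 → ℝ))
    (_ : Module.finrank ℝ V = k + 1)
    (_ : ∀ f ∈ V, ContDiff ℝ (⊤ : ℕ∞) f)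
    (_ : ∀ f ∈ V, ∀ᶠ x in nhdsSet ΓD, f x = 0)
    (_ : ∀ f ∈ V, Set.EqOn f 0 (closure Ω) → f = 0),
    ⨆ f ∈ V, ⨆ (_ : ¬ Set.EqOn f 0 (closure Ω)), rayleigh Ω ΓS ρ f

def steklovN (Ω ΓS : Set E2) (k : ℕ) : ℝ≥0∞ :=
  steklovMixed Ω ΓS ∅ (fun _ => 1) k

def steklovD (Ω ΓS ΓD : Set E2) (k : ℕ) : ℝ≥0∞ :=
  steklovMixed Ω ΓS ΓD (fun _ => 1) k

def steklovW (Ω : Set E2) (ρ : E2 → ℝ) (k : ℕ) : ℝ≥0∞ :=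
  steklovMixed Ω (frontier Ω) ∅ ρ k

def steklov (Ω : Set E2) (k : ℕ) : ℝ≥0∞ := steklovW Ω (fun _ => 1) k

def IsArc (A : Set E2) : Prop :=
  ∃ γ : ℝ → E2, ContinuousOn γ (Icc 0 1) ∧ InjOn γ (Icc 0 1) ∧ A = γ '' Icc 0 1

def IsLoop (A : Set E2) : Prop :=
  ∃ γ : ℝ → E2, ContinuousOn γ (Icc 0 1) ∧ InjOn γ (Ico 0 1) ∧ γ 0 = γ 1 ∧ A = γ '' Icc 0 1

def IsBoundaryPart (Γ : Set E2) : Prop :=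
  ∃ F : Finset (Set E2), (∀ A ∈ F, IsArc A ∨ IsLoop A) ∧ Γ = ⋃₀ ↑F

structure SteklovDecomp (Ω ΓS Γstar : Set E2) : Prop where
  partS : IsBoundaryPart ΓS
  partStar : IsBoundaryPart Γstar
  union_eq : ΓS ∪ Γstar = frontier Ω
  inter_finite : (ΓS ∩ Γstar).Finite
  nonemptyS : ΓS.Nonempty

/-- Rotation of the plane by angle θ about the origin. -/
def rotBy (θ : ℝ) : E2 → E2 := fun x =>
  (WithLp.equiv 2 (Fin 2 → ℝ)).symm
    ![Real.cos θ * x 0 - Real.sin θ * x 1, Real.sin θ * x 0 + Real.cos θ * x 1]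

/-- The class 𝒟_p: simply connected bounded Lipschitz planar domains with rotational
symmetry of order p about the origin, together with a nonnegative rotationally
symmetric L^∞ weight on the boundary that is positive on a set of positive H¹ measure. -/
def MemDp (p : ℕ) (Ω : Set E2) (ρ : E2 → ℝ) : Prop :=
  IsLipschitzDomain Ω ∧ SimplyConnectedSpace Ω ∧
  rotBy (2 * Real.pi / p) '' Ω = Ω ∧
  (∀ x, 0 ≤ ρ x) ∧
  (∃ C : ℝ, ∀ᵐ x ∂(μH[1].restrict (frontier Ω)), ρ x ≤ C) ∧
  0 < μH[1] {x ∈ frontier Ω | 0 < ρ x} ∧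
  (∀ x ∈ frontier Ω, ρ (rotBy (2 * Real.pi / p) x) = ρ x)

/-- The ρ-weighted length L_ρ(∂Ω). -/
def Lweight (Ω : Set E2) (ρ : E2 → ℝ) : ℝ≥0∞ :=
  ∫⁻ x in frontier Ω, ENNReal.ofReal (ρ x) ∂μH[1]

/-- Σ_k^p, the supremum of the normalized k-th Steklov eigenvalue over 𝒟_p. -/
def SigmaP (p k : ℕ) : ℝ≥0∞ :=
  ⨆ (Ω : Set E2) (ρ : E2 → ℝ) (_ : MemDp p Ω ρ), steklovW Ω ρ k * Lweight Ω ρ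

/-- K(p): the set of indices k ≥ 1 for which the disk value σ_k(𝔻)L(∂𝔻) = 2π⌊(k+1)/2⌋
equals the supremum Σ_k^p over the p-fold symmetric class. -/
def KSet (p : ℕ) : Set ℕ :=
  {k : ℕ | 1 ≤ k ∧ SigmaP p k = ENNReal.ofReal (2 * Real.pi * (((k + 1) / 2 : ℕ) : ℝ))}

/-! ### Wirtinger's inequality -/

lemma wirtinger_inequality {h h' : ℝ → ℝ} (hd : ∀ x, HasDerivAt h (h' x) x)
    (hc : Continuous h') (hper : h (-Real.pi) = h Real.pi) :
    (∫ x in -Real.pi..Real.pi, h x ^ 2) - (∫ x in -Real.pi..Real.pi, h x) ^ 2 / (2 * Real.pi)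
      ≤ ∫ x in -Real.pi..Real.pi, h' x ^ 2 := by
  have hpi := Real.pi_pos
  have hab : -Real.pi < Real.pi := by linarith
  have hcont : Continuous h := continuous_iff_continuousAt.2 fun x => (hd x).continuousAt
  have key : ∀ u : ℝ → ℝ, Continuous u →
      HasSum (fun i => ‖fourierCoeffOn hab (fun x => (u x : ℂ)) i‖ ^ 2)
        ((2 * Real.pi)⁻¹ * ∫ x in -Real.pi..Real.pi, u x ^ 2) := by
    intro u hu
    have hm : MemLp (fun x => (u x : ℂ)) 2 (volume.restrict (Ioc (-Real.pi) Real.pi)) := by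
      have hcu : Continuous fun x => (u x : ℂ) := Complex.continuous_ofReal.comp hu
      obtain ⟨C, hC⟩ := isCompact_Icc.exists_bound_of_continuousOn
        (s := Icc (-Real.pi) Real.pi) hcu.continuousOn
      refine MemLp.of_bound hcu.aestronglyMeasurable C ?_
      filter_upwards [ae_restrict_mem measurableSet_Ioc] with x hx
      exact hC x (Ioc_subset_Icc_self hx)
    have := hasSum_sq_fourierCoeffOn hab hm
    simp only [Complex.norm_real, Real.norm_eq_abs, sq_abs, smul_eq_mul] at this
    rwa [show Real.pi - -Real.pi = 2 * Real.pi by ring] at this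
  have h1 := key h hcont
  have h2 := key h' hc
  have h0 : ‖fourierCoeffOn hab (fun x => (h x : ℂ)) 0‖ ^ 2
      = ((2 * Real.pi)⁻¹ * ∫ x in -Real.pi..Real.pi, h x) ^ 2 := by
    rw [fourierCoeffOn_eq_integral]
    simp only [neg_zero, fourier_zero, one_smul]
    rw [intervalIntegral.integral_ofReal, show Real.pi - -Real.pi = 2 * Real.pi by ring,
      one_div, Complex.real_smul, ← Complex.ofReal_mul, Complex.norm_real, Real.norm_eq_abs, sq_abs]
  have hle := hasSum_le (f := fun i => ‖fourierCoeffOn hab (fun x => (h x : ℂ)) i‖ ^ 2 -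
      if i = 0 then ‖fourierCoeffOn hab (fun x => (h x : ℂ)) 0‖ ^ 2 else 0) ?_
      (h1.sub (hasSum_ite_eq 0 _)) h2
  · rw [h0] at hle
    have h3 := mul_le_mul_of_nonneg_left hle (by positivity : (0:ℝ) ≤ 2 * Real.pi)
    have e1 : 2 * Real.pi * ((2 * Real.pi)⁻¹ * (∫ x in -Real.pi..Real.pi, h x ^ 2) -
        ((2 * Real.pi)⁻¹ * ∫ x in -Real.pi..Real.pi, h x) ^ 2) =
        (∫ x in -Real.pi..Real.pi, h x ^ 2) -
          (∫ x in -Real.pi..Real.pi, h x) ^ 2 / (2 * Real.pi) := by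
      field_simp
    have e2 : 2 * Real.pi * ((2 * Real.pi)⁻¹ * (∫ x in -Real.pi..Real.pi, h' x ^ 2)) =
        ∫ x in -Real.pi..Real.pi, h' x ^ 2 := by
      field_simp
    linarith
  · intro n
    by_cases hn : n = 0
    · subst hn; simp
    · simp only [hn, if_false, sub_zero]
      have := fourierCoeffOn_of_hasDerivAt hab (f := fun x => (h x : ℂ))
        (f' := fun x => (h' x : ℂ)) hn (fun x _ => (hd x).ofReal_comp)
        ((Complex.continuous_ofReal.comp hc).intervalIntegrable _ _)
      rw [this, hper, sub_self, mul_zero, zero_sub, norm_mul, norm_neg, norm_mul]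
      have e3 : ‖((Real.pi : ℂ) - ((-Real.pi : ℝ) : ℂ))‖ = 2 * Real.pi := by
        rw [← Complex.ofReal_sub, Complex.norm_real, Real.norm_eq_abs,
          show Real.pi - -Real.pi = 2 * Real.pi by ring, abs_of_pos (by positivity)]
      have e4 : ‖(1 / (-2 * Real.pi * Complex.I * n) : ℂ)‖ = 1 / (2 * Real.pi * |(n : ℝ)|) := by
        simp [abs_of_pos hpi]
      rw [e3, e4]
      have hn1 : (1 : ℝ) ≤ |(n : ℝ)| := by
        exact_mod_cast Int.one_le_abs hn
      set c := ‖fourierCoeffOn hab (fun x => (h' x : ℂ)) n‖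
      have hc0 : 0 ≤ c := norm_nonneg _
      have : 1 / (2 * Real.pi * |(n : ℝ)|) * (2 * Real.pi * c) = c / |(n : ℝ)| := by
        field_simp
      rw [this]
      gcongr
      exact div_le_self hc0 hn1


/-! ### The sharp trace inequality on a disk -/

/-- The point of the unit circle with argument `θ`. -/
def circPt (θ : ℝ) : ℂ := Complex.exp (θ * Complex.I)

lemma norm_circPt (θ : ℝ) : ‖circPt θ‖ = 1 := Complex.norm_exp_ofReal_mul_I θ

@[fun_prop]
lemma continuous_circPt : Continuous circPt := by unfold circPt; fun_prop

lemma hasDerivAt_circPt (θ : ℝ) : HasDerivAt circPt (circPt θ * Complex.I) θ := by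
  have h : HasDerivAt (fun x : ℝ => (x : ℂ) * Complex.I) (1 * Complex.I) θ :=
    (Complex.ofRealCLM.hasDerivAt (x := θ)).mul_const _
  rw [one_mul] at h
  exact h.cexp

lemma norm_smul_circPt (r θ : ℝ) : ‖(r : ℂ) * circPt θ‖ = |r| := by
  simp [norm_circPt]

/-- `g` is continuously differentiable near every point of the closed unit disk. -/
def SmoothOnDisk (g : ℂ → ℝ) : Prop := ∀ w : ℂ, ‖w‖ ≤ 1 → ContDiffAt ℝ 1 g w

namespace SmoothOnDisk

variable {g : ℂ → ℝ}

lemma hasFDerivAt (hg : SmoothOnDisk g) {w : ℂ} (hw : ‖w‖ ≤ 1) :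
    HasFDerivAt g (fderiv ℝ g w) w :=
  ((hg w hw).differentiableAt one_ne_zero).hasFDerivAt

lemma continuousOn (hg : SmoothOnDisk g) : ContinuousOn g (closedBall 0 1) := fun w hw =>
  (hg w (by simpa using hw)).continuousAt.continuousWithinAt

lemma continuousOn_fderiv (hg : SmoothOnDisk g) :
    ContinuousOn (fderiv ℝ g) (closedBall 0 1) := fun w hw =>
  ((hg w (by simpa using hw)).fderiv_right (m := 0) (by norm_num)).continuousAt.continuousWithinAt

lemma pow_two (hg : SmoothOnDisk g) : SmoothOnDisk (fun w => g w ^ 2) := fun w hw =>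
  (hg w hw).pow 2

lemma continuous_circle (hg : SmoothOnDisk g) {r : ℝ} (hr : |r| ≤ 1) :
    Continuous fun θ : ℝ => g (r * circPt θ) :=
  hg.continuousOn.comp_continuous (by fun_prop) fun θ => by simpa [norm_circPt] using hr

lemma continuous_fderiv_circle (hg : SmoothOnDisk g) {r : ℝ} (hr : |r| ≤ 1) :
    Continuous fun θ : ℝ => fderiv ℝ g (r * circPt θ) :=
  hg.continuousOn_fderiv.comp_continuous (by fun_prop) fun θ => by simpa [norm_circPt] using hr

lemma hasDerivAt_radial (hg : SmoothOnDisk g) {r : ℝ} (hr : |r| ≤ 1) (θ : ℝ) :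
    HasDerivAt (fun r : ℝ => g (r * circPt θ)) (fderiv ℝ g (r * circPt θ) (circPt θ)) r := by
  have h : HasDerivAt (fun x : ℝ => (x : ℂ) * circPt θ) (1 * circPt θ) r :=
    (Complex.ofRealCLM.hasDerivAt (x := r)).mul_const _
  rw [one_mul] at h
  exact (hg.hasFDerivAt (by rwa [norm_smul_circPt])).comp_hasDerivAt r h

lemma hasDerivAt_angular (hg : SmoothOnDisk g) {r : ℝ} (hr : |r| ≤ 1) (θ : ℝ) :
    HasDerivAt (fun θ : ℝ => g (r * circPt θ))
      (fderiv ℝ g (r * circPt θ) (r * (circPt θ * Complex.I))) θ :=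
  (hg.hasFDerivAt (by rwa [norm_smul_circPt])).comp_hasDerivAt θ
    ((hasDerivAt_circPt θ).const_mul (r : ℂ))

lemma hasDerivAt_integral_circle (hg : SmoothOnDisk g) {r : ℝ} (hr : |r| < 1) :
    HasDerivAt (fun r : ℝ => ∫ θ in -Real.pi..Real.pi, g (r * circPt θ))
      (∫ θ in -Real.pi..Real.pi, fderiv ℝ g (r * circPt θ) (circPt θ)) r := by
  obtain ⟨C, hC⟩ := (isCompact_closedBall (0 : ℂ) 1).exists_bound_of_continuousOn
    hg.continuousOn_fderiv
  refine (intervalIntegral.hasDerivAt_integral_of_dominated_loc_of_deriv_le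
    (F := fun (x t : ℝ) => g (x * circPt t))
    (F' := fun x t => fderiv ℝ g (x * circPt t) (circPt t)) (bound := fun _ => C)
    (s := Ioo (-1) 1) (Ioo_mem_nhds (abs_lt.1 hr).1 (abs_lt.1 hr).2) ?_ ?_ ?_ ?_ ?_ ?_).2
  · filter_upwards [Ioo_mem_nhds (abs_lt.1 hr).1 (abs_lt.1 hr).2] with x hx
    exact (hg.continuous_circle (abs_lt.2 hx).le).aestronglyMeasurable
  · exact (hg.continuous_circle hr.le).intervalIntegrable _ _
  · exact ((hg.continuous_fderiv_circle hr.le).clm_apply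
      continuous_circPt).aestronglyMeasurable
  · refine Eventually.of_forall fun t _ x hx => ?_
    refine ((fderiv ℝ g (x * circPt t)).le_opNorm _).trans ?_
    rw [norm_circPt, mul_one]
    exact hC _ (by simpa [norm_circPt] using (abs_lt.2 hx).le)
  · exact intervalIntegrable_const
  · exact Eventually.of_forall fun t _ x hx => hg.hasDerivAt_radial (abs_lt.2 hx).le t

end SmoothOnDisk

lemma sq_add_sq_le_opNorm_sq (L : ℂ →L[ℝ] ℝ) {e : ℂ} (he : ‖e‖ = 1) :
    L e ^ 2 + L (e * Complex.I) ^ 2 ≤ ‖L‖ ^ 2 := by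
  set a := L e
  set b := L (e * Complex.I)
  have h1 : L (a • e + b • (e * Complex.I)) = a ^ 2 + b ^ 2 := by
    rw [map_add, map_smul, map_smul]; simp only [smul_eq_mul]; ring
  have h2 : ‖a • e + b • (e * Complex.I)‖ ^ 2 = a ^ 2 + b ^ 2 := by
    have : a • e + b • (e * Complex.I) = (a + b * Complex.I) * e := by
      simp only [Complex.real_smul]; ring
    rw [this, norm_mul, he, mul_one, Complex.sq_norm, Complex.normSq_add_mul_I]
  have h3 := (le_abs_self _).trans (L.le_opNorm (a • e + b • (e * Complex.I)))
  rw [h1] at h3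
  set n := ‖a • e + b • (e * Complex.I)‖
  have hn : 0 ≤ n := norm_nonneg _
  rw [← h2] at h3 ⊢
  rcases hn.eq_or_lt with h | h
  · rw [← h, zero_pow two_ne_zero]; positivity
  · have : n ≤ ‖L‖ := by nlinarith
    gcongr

lemma variance_deriv_le {G R T Q : ℝ → ℝ} {r : ℝ} (h0 : 0 < r) (cG : Continuous G)
    (cR : Continuous R) (cT : Continuous T) (cQ : Continuous Q)
    (hW : (∫ θ in -Real.pi..Real.pi, G θ ^ 2) -
      (∫ θ in -Real.pi..Real.pi, G θ) ^ 2 / (2 * Real.pi) ≤ ∫ θ in -Real.pi..Real.pi, T θ ^ 2)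
    (hQ : ∀ θ, r * R θ ^ 2 + r⁻¹ * T θ ^ 2 ≤ Q θ) :
    (∫ θ in -Real.pi..Real.pi, 2 * G θ * R θ) -
      2 * (∫ θ in -Real.pi..Real.pi, G θ) * (∫ θ in -Real.pi..Real.pi, R θ) / (2 * Real.pi)
      ≤ ∫ θ in -Real.pi..Real.pi, Q θ := by
  have hpi := Real.pi_pos
  have ii : ∀ {u : ℝ → ℝ}, Continuous u → IntervalIntegrable u volume (-Real.pi) Real.pi :=
    fun hu => hu.intervalIntegrable _ _
  set m := (∫ θ in -Real.pi..Real.pi, G θ) / (2 * Real.pi) with hm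
  have hvar : (∫ θ in -Real.pi..Real.pi, (G θ - m) ^ 2) =
      (∫ θ in -Real.pi..Real.pi, G θ ^ 2) -
        (∫ θ in -Real.pi..Real.pi, G θ) ^ 2 / (2 * Real.pi) := by
    have : ∀ θ, (G θ - m) ^ 2 = G θ ^ 2 - (2 * m) * G θ + m ^ 2 := fun θ => by ring
    simp only [this]
    rw [intervalIntegral.integral_add (ii (by fun_prop)) (ii (by fun_prop)),
      intervalIntegral.integral_sub (ii (by fun_prop)) (ii (by fun_prop)),
      intervalIntegral.integral_const_mul, intervalIntegral.integral_const, hm]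
    simp only [smul_eq_mul]
    field_simp
    ring
  calc _ = ∫ θ in -Real.pi..Real.pi, 2 * (G θ - m) * R θ := by
        have : ∀ θ, 2 * (G θ - m) * R θ = 2 * G θ * R θ - (2 * m) * R θ := fun θ => by ring
        simp only [this]
        rw [intervalIntegral.integral_sub (ii (by fun_prop)) (ii (by fun_prop)),
          intervalIntegral.integral_const_mul (2 * m), hm]
        ring
    _ ≤ ∫ θ in -Real.pi..Real.pi, (r * R θ ^ 2 + r⁻¹ * (G θ - m) ^ 2) := by
        refine intervalIntegral.integral_mono_on (by linarith) (ii (by fun_prop))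
          (ii (by fun_prop)) fun θ _ => ?_
        have : r * R θ ^ 2 + r⁻¹ * (G θ - m) ^ 2 - 2 * (G θ - m) * R θ =
            r⁻¹ * (r * R θ - (G θ - m)) ^ 2 := by
          field_simp; ring
        have : 0 ≤ r⁻¹ * (r * R θ - (G θ - m)) ^ 2 := by positivity
        linarith
    _ = (∫ θ in -Real.pi..Real.pi, r * R θ ^ 2) +
          r⁻¹ * ∫ θ in -Real.pi..Real.pi, (G θ - m) ^ 2 := by
        rw [intervalIntegral.integral_add (ii (by fun_prop)) (ii (by fun_prop)),
          intervalIntegral.integral_const_mul r⁻¹]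
    _ ≤ (∫ θ in -Real.pi..Real.pi, r * R θ ^ 2) +
          r⁻¹ * ∫ θ in -Real.pi..Real.pi, T θ ^ 2 := by
        rw [hvar]; gcongr
    _ = ∫ θ in -Real.pi..Real.pi, (r * R θ ^ 2 + r⁻¹ * T θ ^ 2) := by
        rw [intervalIntegral.integral_add (ii (by fun_prop)) (ii (by fun_prop)),
          intervalIntegral.integral_const_mul r⁻¹]
    _ ≤ ∫ θ in -Real.pi..Real.pi, Q θ :=
        intervalIntegral.integral_mono_on (by linarith) (ii (by fun_prop)) (ii cQ)
          fun θ _ => hQ θ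

/-- The Dirichlet energy density of `g` on the circle of radius `r`, in polar coordinates. -/
def circEnergy (g : ℂ → ℝ) (r : ℝ) : ℝ :=
  ∫ θ in -Real.pi..Real.pi, r * ‖fderiv ℝ g (r * circPt θ)‖ ^ 2

namespace SmoothOnDisk

variable {g : ℂ → ℝ}

lemma continuousOn_circEnergy (hg : SmoothOnDisk g) : ContinuousOn (circEnergy g) (Icc 0 1) := by
  have h : Continuous fun r : ℝ => ∫ θ in -Real.pi..Real.pi,
      (projIcc (0:ℝ) 1 zero_le_one r : ℝ) *
        ‖fderiv ℝ g ((projIcc (0:ℝ) 1 zero_le_one r : ℝ) * circPt θ)‖ ^ 2 := by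
    apply intervalIntegral.continuous_parametric_intervalIntegral_of_continuous'
    have h1 : Continuous fun p : ℝ × ℝ => (projIcc (0:ℝ) 1 zero_le_one p.1 : ℝ) :=
      continuous_subtype_val.comp (continuous_projIcc.comp continuous_fst)
    refine h1.mul (Continuous.pow (Continuous.norm ?_) 2)
    refine hg.continuousOn_fderiv.comp_continuous
      (f := fun p : ℝ × ℝ => ((projIcc (0:ℝ) 1 zero_le_one p.1 : ℝ) : ℂ) * circPt p.2)
      (by fun_prop) fun p => ?_
    have := (projIcc (0:ℝ) 1 zero_le_one p.1).2
    simp only [mem_closedBall, dist_zero_right, norm_smul_circPt]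
    rw [abs_of_nonneg this.1]; exact this.2
  refine h.continuousOn.congr fun r hr => ?_
  simp only [circEnergy, projIcc_of_mem _ hr]

lemma variance_circle_deriv_le (hg : SmoothOnDisk g) {r : ℝ} (h0 : 0 < r) (h1 : r < 1) :
    (∫ θ in -Real.pi..Real.pi, fderiv ℝ (fun w => g w ^ 2) (r * circPt θ) (circPt θ)) -
      2 * (∫ θ in -Real.pi..Real.pi, g (r * circPt θ)) *
        (∫ θ in -Real.pi..Real.pi, fderiv ℝ g (r * circPt θ) (circPt θ)) / (2 * Real.pi)
      ≤ circEnergy g r := by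
  have hr : |r| ≤ 1 := by rw [abs_of_pos h0]; exact h1.le
  have hw : ∀ θ, ‖(r : ℂ) * circPt θ‖ ≤ 1 := fun θ => by rwa [norm_smul_circPt]
  have cF := hg.continuous_fderiv_circle hr
  have cT : Continuous fun θ => fderiv ℝ g (r * circPt θ) (r * (circPt θ * Complex.I)) :=
    cF.clm_apply (by fun_prop)
  have e1 : ∀ θ, fderiv ℝ (fun w => g w ^ 2) (r * circPt θ) (circPt θ) =
      2 * g (r * circPt θ) * fderiv ℝ g (r * circPt θ) (circPt θ) := fun θ => by
    rw [((hg.hasFDerivAt (hw θ)).pow 2).fderiv]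
    simp
  simp only [e1]
  refine variance_deriv_le h0 (hg.continuous_circle hr) (cF.clm_apply continuous_circPt) cT
    (Continuous.mul continuous_const (cF.norm.pow 2))
    (wirtinger_inequality (fun θ => hg.hasDerivAt_angular hr θ) cT ?_) fun θ => ?_
  · simp only [circPt, Complex.ofReal_neg, neg_mul, Complex.exp_neg, Complex.exp_pi_mul_I]
    norm_num
  · have h := sq_add_sq_le_opNorm_sq (fderiv ℝ g (r * circPt θ)) (norm_circPt θ)
    set L := fderiv ℝ g (r * circPt θ)
    have e2 : L (r * (circPt θ * Complex.I)) = r * L (circPt θ * Complex.I) := by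
      rw [← Complex.real_smul, map_smul, smul_eq_mul]
    have e3 : r⁻¹ * (r * L (circPt θ * Complex.I)) ^ 2 = r * L (circPt θ * Complex.I) ^ 2 := by
      field_simp
    rw [e2, e3, ← mul_add]
    gcongr

/-- The variance of the boundary values on a circle is at most the energy inside. -/
lemma variance_circle_le (hg : SmoothOnDisk g) {r : ℝ} (h0 : 0 ≤ r) (h1 : r < 1) :
    (∫ θ in -Real.pi..Real.pi, g (r * circPt θ) ^ 2) -
      (∫ θ in -Real.pi..Real.pi, g (r * circPt θ)) ^ 2 / (2 * Real.pi)
      ≤ ∫ s in (0:ℝ)..r, circEnergy g s := by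
  have hpi := Real.pi_pos
  set ψ : ℝ → ℝ := fun r => (∫ θ in -Real.pi..Real.pi, g (r * circPt θ) ^ 2) -
      (∫ θ in -Real.pi..Real.pi, g (r * circPt θ)) ^ 2 / (2 * Real.pi) with hψ
  have hd : ∀ s : ℝ, |s| < 1 → HasDerivAt ψ
      ((∫ θ in -Real.pi..Real.pi, fderiv ℝ (fun w => g w ^ 2) (s * circPt θ) (circPt θ)) -
      2 * (∫ θ in -Real.pi..Real.pi, g (s * circPt θ)) *
        (∫ θ in -Real.pi..Real.pi, fderiv ℝ g (s * circPt θ) (circPt θ)) / (2 * Real.pi)) s := by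
    intro s hs
    have := (hg.pow_two.hasDerivAt_integral_circle hs).sub
      (((hg.hasDerivAt_integral_circle hs).pow 2).div_const (2 * Real.pi))
    exact this.congr_deriv (by simp)
  have hs : ∀ s ∈ Icc 0 r, |s| < 1 := fun s hs => by
    rw [abs_of_nonneg hs.1]; exact hs.2.trans_lt h1
  have := intervalIntegral.sub_le_integral_of_hasDeriv_right_of_le h0
    (fun s hs' => (hd s (hs s hs')).continuousAt.continuousWithinAt)
    (fun s hs' => (hd s (hs s (Ioo_subset_Icc_self hs'))).hasDerivWithinAt)
    ((hg.continuousOn_circEnergy.mono (Icc_subset_Icc_right h1.le)).integrableOn_Icc)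
    (fun s hs' => hg.variance_circle_deriv_le hs'.1 (hs'.2.trans h1))
  have h00 : ψ 0 = 0 := by
    simp only [hψ, Complex.ofReal_zero, zero_mul, intervalIntegral.integral_const, smul_eq_mul]
    field_simp
    ring
  rwa [h00, sub_zero] at this

end SmoothOnDisk


/-! ### Trace inequality on a disk with part of the outer collar removed -/

lemma sq_integral_le {a b : ℝ} (hab : a < b) {R : ℝ → ℝ} (hR : ContinuousOn R (Icc a b)) :
    (∫ s in a..b, R s) ^ 2 ≤ (b - a) * ∫ s in a..b, R s ^ 2 := by
  have hu : uIcc a b = Icc a b := uIcc_of_le hab.le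
  have i1 : IntervalIntegrable R volume a b := (hu ▸ hR).intervalIntegrable
  have i2 : IntervalIntegrable (fun s => R s ^ 2) volume a b := (hu ▸ hR.pow 2).intervalIntegrable
  have hba : 0 < b - a := sub_pos.2 hab
  set m := (∫ s in a..b, R s) / (b - a) with hm
  have h0 : 0 ≤ ∫ s in a..b, (R s - m) ^ 2 :=
    intervalIntegral.integral_nonneg hab.le fun s _ => sq_nonneg _
  have h1 : (∫ s in a..b, (R s - m) ^ 2) =
      (∫ s in a..b, R s ^ 2) - (∫ s in a..b, R s) ^ 2 / (b - a) := by
    have : ∀ s, (R s - m) ^ 2 = R s ^ 2 - (2 * m) * R s + m ^ 2 := fun s => by ring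
    simp only [this]
    rw [intervalIntegral.integral_add (i2.sub (i1.const_mul _)) intervalIntegrable_const,
      intervalIntegral.integral_sub i2 (i1.const_mul _), intervalIntegral.integral_const_mul,
      intervalIntegral.integral_const, hm]
    simp only [smul_eq_mul]
    field_simp
    ring
  rw [h1, sub_nonneg, div_le_iff₀ hba] at h0
  linarith

namespace SmoothOnDisk

variable {g : ℂ → ℝ}

lemma continuousOn_radial_energy (hg : SmoothOnDisk g) (θ : ℝ) :
    ContinuousOn (fun s : ℝ => s * ‖fderiv ℝ g (s * circPt θ)‖ ^ 2) (Icc 0 1) := by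
  refine continuousOn_id.mul (ContinuousOn.pow (ContinuousOn.norm ?_) 2)
  refine hg.continuousOn_fderiv.comp (by fun_prop) fun s hs => ?_
  simp only [mem_closedBall, dist_zero_right, norm_smul_circPt]
  rw [abs_of_nonneg hs.1]; exact hs.2

lemma sq_boundary_le (hg : SmoothOnDisk g) {r : ℝ} (h0 : 0 < r) (h1 : r < 1) (θ : ℝ) :
    g (circPt θ) ^ 2 ≤ 1 / r * (g (r * circPt θ) ^ 2 +
      ∫ s in r..1, s * ‖fderiv ℝ g (s * circPt θ)‖ ^ 2) := by
  have hs : ∀ s ∈ Icc r 1, |s| ≤ 1 := fun s hs => by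
    rw [abs_of_nonneg (h0.le.trans hs.1)]; exact hs.2
  have hsub : Icc r 1 ⊆ Icc (0:ℝ) 1 := Icc_subset_Icc_left h0.le
  have cR : ContinuousOn (fun s : ℝ => fderiv ℝ g (s * circPt θ) (circPt θ)) (Icc r 1) := by
    refine ContinuousOn.clm_apply ?_ continuousOn_const
    refine hg.continuousOn_fderiv.comp (by fun_prop) fun s hs' => ?_
    simpa [norm_circPt] using hs s hs'
  have hu : uIcc r 1 = Icc r 1 := uIcc_of_le h1.le
  have hF := intervalIntegral.integral_eq_sub_of_hasDerivAt
    (f := fun s : ℝ => g (s * circPt θ)) (f' := fun s : ℝ => fderiv ℝ g (s * circPt θ) (circPt θ))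
    (a := r) (b := 1) (fun s hs' => hg.hasDerivAt_radial (hs s (hu ▸ hs')) θ)
    ((hu ▸ cR).intervalIntegrable)
  simp only [Complex.ofReal_one, one_mul] at hF
  have hCS := sq_integral_le h1 cR
  have hmono : r * (∫ s in r..1, (fderiv ℝ g (s * circPt θ) (circPt θ)) ^ 2) ≤
      ∫ s in r..1, s * ‖fderiv ℝ g (s * circPt θ)‖ ^ 2 := by
    rw [← intervalIntegral.integral_const_mul]
    refine intervalIntegral.integral_mono_on h1.le
      (hu ▸ (continuousOn_const.mul (cR.pow 2))).intervalIntegrable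
      (hu ▸ (hg.continuousOn_radial_energy θ).mono hsub).intervalIntegrable fun s hs' => ?_
    have := sq_add_sq_le_opNorm_sq (fderiv ℝ g (s * circPt θ)) (norm_circPt θ)
    have h2 : (fderiv ℝ g (s * circPt θ) (circPt θ)) ^ 2 ≤ ‖fderiv ℝ g (s * circPt θ)‖ ^ 2 := by
      nlinarith [sq_nonneg (fderiv ℝ g (s * circPt θ) (circPt θ * Complex.I))]
    have h3 : 0 < s := h0.trans_le hs'.1
    exact mul_le_mul hs'.1 h2 (sq_nonneg _) h3.le
  rw [hF] at hCS
  set E := ∫ s in r..1, s * ‖fderiv ℝ g (s * circPt θ)‖ ^ 2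
  set J := ∫ s in r..1, (fderiv ℝ g (s * circPt θ) (circPt θ)) ^ 2
  set x := g (r * circPt θ)
  set y := g (circPt θ)
  have hJ : (y - x) ^ 2 * r ≤ (1 - r) * E := by
    have : (y - x) ^ 2 * r ≤ (1 - r) * J * r := by gcongr
    nlinarith
  rw [one_div, inv_mul_eq_div, le_div_iff₀ h0]
  have h1r : 0 < 1 - r := by linarith
  have hk : 0 ≤ ((1 - r) * x - r * (y - x)) ^ 2 := sq_nonneg _
  have : (1 - r) * (y ^ 2 * r) ≤ (1 - r) * (x ^ 2 + E) := by nlinarith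
  exact le_of_mul_le_mul_left this h1r

/-- If the mean of `g` on the circle of radius `r` vanishes, the energy of `g` on the disk of
radius `r` together with the part of the unit disk over the arc `A` controls the boundary values
on `A`. -/
lemma lintegral_arc_le (hg : SmoothOnDisk g) {r : ℝ} (h0 : 0 < r) (h1 : r < 1) {A : Set ℝ}
    (hA : MeasurableSet A) (hA' : A ⊆ Ioo (-Real.pi) Real.pi)
    (hmean : ∫ θ in -Real.pi..Real.pi, g (r * circPt θ) = 0) :
    ∫⁻ θ in A, ENNReal.ofReal (g (circPt θ) ^ 2) ≤ ENNReal.ofReal (1 / r) *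
      ∫⁻ z in {z : ℂ | ‖z‖ < r ∨ ‖z‖ < 1 ∧ z.arg ∈ A}, (‖fderiv ℝ g z‖₊ : ℝ≥0∞) ^ 2 := by
  have hpi := Real.pi_pos
  set q : ℂ → ℝ≥0∞ := fun z => (‖fderiv ℝ g z‖₊ : ℝ≥0∞) ^ 2 with hq
  have hqm : Measurable q := by
    have : Measurable (fderiv ℝ g) := measurable_fderiv ℝ g
    fun_prop
  have hqr : ∀ s : ℝ, 0 ≤ s → ∀ z, ENNReal.ofReal (s * ‖fderiv ℝ g z‖ ^ 2) =
      ENNReal.ofReal s * q z := fun s hs z => by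
    rw [ENNReal.ofReal_mul hs, ENNReal.ofReal_pow (norm_nonneg _), ofReal_norm]; rfl
  set Q : ℝ × ℝ → ℝ≥0∞ := fun p => ENNReal.ofReal p.1 * q (p.1 * circPt p.2) with hQ
  have hQm : Measurable Q := by
    have : Measurable fun p : ℝ × ℝ => (p.1 : ℂ) * circPt p.2 :=
      (show Continuous fun p : ℝ × ℝ => (p.1 : ℂ) * circPt p.2 by fun_prop).measurable
    exact (ENNReal.measurable_ofReal.comp measurable_fst).mul (hqm.comp this)
  set S1 : Set (ℝ × ℝ) := Ioo 0 r ×ˢ Ioo (-Real.pi) Real.pi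
  set S2 : Set (ℝ × ℝ) := Ioo r 1 ×ˢ A
  have hpolar : (∫⁻ p in S1, Q p) + ∫⁻ p in S2, Q p ≤
      ∫⁻ z in {z : ℂ | ‖z‖ < r ∨ ‖z‖ < 1 ∧ z.arg ∈ A}, q z := by
    have hU : MeasurableSet {z : ℂ | ‖z‖ < r ∨ ‖z‖ < 1 ∧ z.arg ∈ A} := by
      refine (measurableSet_lt measurable_norm measurable_const).union
        ((measurableSet_lt measurable_norm measurable_const).inter (Complex.measurable_arg hA))
    have hdisj : Disjoint S1 S2 := by
      refine Set.disjoint_left.2 fun p hp1 hp2 => ?_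
      exact absurd hp1.1.2 (not_lt.2 hp2.1.1.le)
    rw [← lintegral_union (measurableSet_Ioo.prod hA) hdisj, ← lintegral_indicator hU,
      ← Complex.lintegral_comp_polarCoord_symm]
    have hS : S1 ∪ S2 ⊆ polarCoord.target := by
      rw [polarCoord_target]
      rintro p (hp | hp)
      · exact ⟨hp.1.1, hp.2⟩
      · exact ⟨h0.trans hp.1.1, hA' hp.2⟩
    refine le_trans (le_of_eq ?_) (lintegral_mono_set hS)
    refine setLIntegral_congr_fun ((measurableSet_Ioo.prod measurableSet_Ioo).union
      (measurableSet_Ioo.prod hA)) fun p hp => ?_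
    have hp' := hS hp
    rw [polarCoord_target] at hp'
    have hp0 : 0 < p.1 := hp'.1
    have e1 : Complex.polarCoord.symm p = p.1 * circPt p.2 := by
      rw [Complex.polarCoord_symm_apply, circPt, Complex.exp_mul_I]
      push_cast; ring
    have e2 : ((p.1 : ℂ) * circPt p.2).arg = p.2 := by
      rw [circPt, Complex.exp_mul_I]
      exact Complex.arg_mul_cos_add_sin_mul_I hp0 (Ioo_subset_Ioc_self hp'.2)
    rw [e1, smul_eq_mul, indicator_of_mem]
    rcases hp with hp | hp
    · left; rw [norm_smul_circPt, abs_of_pos hp0]; exact hp.1.2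
    · right; rw [norm_smul_circPt, abs_of_pos hp0, e2]; exact ⟨hp.1.2, hp.2⟩
  have hS1 : ∫⁻ p in S1, Q p = ENNReal.ofReal (∫ s in (0:ℝ)..r, circEnergy g s) := by
    have hnn : ∀ s : ℝ, 0 ≤ s → 0 ≤ circEnergy g s := fun s hs =>
      intervalIntegral.integral_nonneg (by linarith) fun θ _ => by positivity
    rw [intervalIntegral.integral_of_le h0.le, ofReal_integral_eq_lintegral_ofReal
      ((hg.continuousOn_circEnergy.mono (Icc_subset_Icc_right h1.le)).integrableOn_Icc.mono_set
        Ioc_subset_Icc_self)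
      ((ae_restrict_mem measurableSet_Ioc).mono fun s hs => hnn s hs.1.le),
      ← restrict_Ioo_eq_restrict_Ioc, Measure.volume_eq_prod, ← Measure.prod_restrict,
      lintegral_prod _ hQm.aemeasurable]
    refine setLIntegral_congr_fun measurableSet_Ioo fun s hs => ?_
    have hs1 : |s| ≤ 1 := by rw [abs_of_pos hs.1]; exact (hs.2.trans h1).le
    have hc : Continuous fun θ => s * ‖fderiv ℝ g (s * circPt θ)‖ ^ 2 :=
      continuous_const.mul ((hg.continuous_fderiv_circle hs1).norm.pow 2)
    rw [circEnergy, intervalIntegral.integral_of_le (by linarith),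
      ofReal_integral_eq_lintegral_ofReal
      (hc.integrableOn_Icc.mono_set Ioc_subset_Icc_self)
      (Eventually.of_forall fun θ => by have := hs.1.le; positivity),
      ← restrict_Ioo_eq_restrict_Ioc]
    exact lintegral_congr fun θ => (hqr s hs.1.le _).symm
  have hS2 : ∫⁻ p in S2, Q p = ∫⁻ θ in A, ENNReal.ofReal
      (∫ s in r..1, s * ‖fderiv ℝ g (s * circPt θ)‖ ^ 2) := by
    rw [Measure.volume_eq_prod, ← Measure.prod_restrict, lintegral_prod_symm _ hQm.aemeasurable]
    refine lintegral_congr fun θ => ?_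
    rw [intervalIntegral.integral_of_le h1.le, ofReal_integral_eq_lintegral_ofReal
      (((hg.continuousOn_radial_energy θ).mono (Icc_subset_Icc_left h0.le)).integrableOn_Icc.mono_set
        Ioc_subset_Icc_self)
      ((ae_restrict_mem measurableSet_Ioc).mono fun s hs => by
        have := h0.trans hs.1
        simp only [Pi.zero_apply]; positivity),
      ← restrict_Ioo_eq_restrict_Ioc]
    exact setLIntegral_congr_fun measurableSet_Ioo fun s hs => (hqr s (h0.trans hs.1).le _).symm
  have hvar := hg.variance_circle_le h0.le h1
  rw [hmean] at hvar
  have hr1 : |r| ≤ 1 := by rw [abs_of_pos h0]; exact h1.le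
  have hcr : Continuous fun θ : ℝ => g (r * circPt θ) ^ 2 := (hg.continuous_circle hr1).pow 2
  have hin : ∫⁻ θ in A, ENNReal.ofReal (g (r * circPt θ) ^ 2) ≤ ∫⁻ p in S1, Q p := by
    rw [hS1]
    refine (lintegral_mono_set (hA'.trans Ioo_subset_Ioc_self)).trans ?_
    rw [← ofReal_integral_eq_lintegral_ofReal (hcr.integrableOn_Icc.mono_set Ioc_subset_Icc_self)
      (Eventually.of_forall fun θ => sq_nonneg _), ← intervalIntegral.integral_of_le (by linarith)]
    exact ENNReal.ofReal_le_ofReal (by simpa using hvar)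
  calc ∫⁻ θ in A, ENNReal.ofReal (g (circPt θ) ^ 2)
      ≤ ∫⁻ θ in A, ENNReal.ofReal (1 / r) * (ENNReal.ofReal (g (r * circPt θ) ^ 2) +
          ENNReal.ofReal (∫ s in r..1, s * ‖fderiv ℝ g (s * circPt θ)‖ ^ 2)) := by
        refine lintegral_mono fun θ => ?_
        rw [← ENNReal.ofReal_add (sq_nonneg _) (intervalIntegral.integral_nonneg h1.le fun s hs =>
          mul_nonneg (h0.le.trans hs.1) (sq_nonneg _)), ← ENNReal.ofReal_mul (by positivity)]
        exact ENNReal.ofReal_le_ofReal (hg.sq_boundary_le h0 h1 θ)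
    _ = ENNReal.ofReal (1 / r) * ((∫⁻ θ in A, ENNReal.ofReal (g (r * circPt θ) ^ 2)) +
          ∫⁻ p in S2, Q p) := by
        rw [lintegral_const_mul' _ _ ENNReal.ofReal_ne_top, lintegral_add_left
          hcr.measurable.ennreal_ofReal, hS2]
    _ ≤ _ := by
        gcongr
        exact (add_le_add_left hin _).trans hpolar

end SmoothOnDisk


/-! ### Möbius transformations of the disk -/

/-- The automorphism `w ↦ ζ (w + a) / (1 + a w)` of the unit disk. -/
def mob (ζ : ℂ) (a : ℝ) (w : ℂ) : ℂ := ζ * ((w + a) / (1 + a * w))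

/-- The inverse of `mob ζ a`. -/
def mobInv (ζ : ℂ) (a : ℝ) (z : ℂ) : ℂ := (ζ⁻¹ * z - a) / (1 - a * (ζ⁻¹ * z))

section Mob

variable {ζ : ℂ} {a : ℝ}

lemma one_add_mul_ne_zero (ha : 0 ≤ a) (ha1 : a < 1) {w : ℂ} (hw : ‖w‖ ≤ 1) :
    1 + (a : ℂ) * w ≠ 0 := by
  intro h
  have h1 : (a : ℂ) * w = -1 := by linear_combination h
  have h2 : a * ‖w‖ = 1 := by
    have := congrArg norm h1
    rwa [norm_mul, Complex.norm_real, Real.norm_of_nonneg ha, norm_neg, norm_one] at this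
  nlinarith [norm_nonneg w]

lemma normSq_add_identity (a : ℝ) (w : ℂ) :
    ‖1 + (a : ℂ) * w‖ ^ 2 - ‖w + a‖ ^ 2 = (1 - a ^ 2) * (1 - ‖w‖ ^ 2) := by
  simp only [← Complex.normSq_eq_norm_sq, Complex.normSq_apply, Complex.add_re, Complex.add_im,
    Complex.one_re, Complex.one_im, Complex.mul_re, Complex.mul_im, Complex.ofReal_re,
    Complex.ofReal_im]
  ring

lemma norm_mob (hζ : ‖ζ‖ = 1) (w : ℂ) : ‖mob ζ a w‖ = ‖w + a‖ / ‖1 + (a : ℂ) * w‖ := by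
  rw [mob, norm_mul, hζ, one_mul, norm_div]

lemma norm_mob_le (hζ : ‖ζ‖ = 1) (ha : 0 ≤ a) (ha1 : a < 1) {w : ℂ} (hw : ‖w‖ ≤ 1) :
    ‖mob ζ a w‖ ≤ 1 := by
  rw [norm_mob hζ, div_le_one (norm_pos_iff.2 (one_add_mul_ne_zero ha ha1 hw))]
  have := normSq_add_identity a w
  refine le_of_sq_le_sq ?_ (norm_nonneg _)
  have : 0 ≤ (1 - a ^ 2) * (1 - ‖w‖ ^ 2) :=
    mul_nonneg (by nlinarith) (by nlinarith [norm_nonneg w])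
  linarith

lemma norm_mob_lt (hζ : ‖ζ‖ = 1) (ha : 0 ≤ a) (ha1 : a < 1) {w : ℂ} (hw : ‖w‖ < 1) :
    ‖mob ζ a w‖ < 1 := by
  rw [norm_mob hζ, div_lt_one (norm_pos_iff.2 (one_add_mul_ne_zero ha ha1 hw.le))]
  have := normSq_add_identity a w
  refine lt_of_pow_lt_pow_left₀ 2 (norm_nonneg _) ?_
  have : 0 < (1 - a ^ 2) * (1 - ‖w‖ ^ 2) :=
    mul_pos (by nlinarith) (by nlinarith [norm_nonneg w])
  linarith

lemma hasDerivAt_mob (ha : 0 ≤ a) (ha1 : a < 1) {w : ℂ} (hw : ‖w‖ ≤ 1) :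
    HasDerivAt (mob ζ a) (ζ * ((1 - a ^ 2) / (1 + a * w) ^ 2)) w := by
  have hne := one_add_mul_ne_zero ha ha1 hw
  have h := ((((hasDerivAt_id w).add_const (a : ℂ)).div
    (((hasDerivAt_id w).const_mul (a : ℂ)).const_add 1) hne).const_mul ζ)
  refine h.congr_deriv ?_
  simp only [id]
  congr 2
  ring

lemma contDiffAt_mob (ha : 0 ≤ a) (ha1 : a < 1) {w : ℂ} (hw : ‖w‖ ≤ 1) :
    ContDiffAt ℝ 1 (mob ζ a) w := by
  have hne := one_add_mul_ne_zero ha ha1 hw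
  have : ContDiffAt ℂ 1 (mob ζ a) w := by
    unfold mob
    exact contDiffAt_const.mul ((contDiffAt_id.add contDiffAt_const).div
      (contDiffAt_const.add (contDiffAt_const.mul contDiffAt_id)) hne)
  exact this.restrict_scalars ℝ

lemma mobInv_mob (hζ : ‖ζ‖ = 1) (ha : 0 ≤ a) (ha1 : a < 1) {w : ℂ} (hw : ‖w‖ ≤ 1) :
    mobInv ζ a (mob ζ a w) = w := by
  have hne := one_add_mul_ne_zero ha ha1 hw
  have hζ0 : ζ ≠ 0 := by rintro rfl; simp at hζ
  have ha2 : (1 - (a : ℂ) ^ 2) ≠ 0 := by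
    have : (1 - a ^ 2 : ℝ) ≠ 0 := by nlinarith
    exact_mod_cast this
  have h1 : ζ⁻¹ * mob ζ a w = (w + a) / (1 + a * w) := by
    rw [mob, inv_mul_cancel_left₀ hζ0]
  have h2 : 1 - (a : ℂ) * ((w + a) / (1 + a * w)) = (1 - a ^ 2) / (1 + a * w) := by
    rw [eq_div_iff hne, sub_mul, mul_assoc, div_mul_cancel₀ _ hne]; ring
  have h3 : (w + a) / (1 + a * w) - (a : ℂ) = w * (1 - a ^ 2) / (1 + a * w) := by
    rw [eq_div_iff hne, sub_mul, div_mul_cancel₀ _ hne]; ring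
  rw [mobInv, h1, h2, h3, div_div_div_cancel_right₀ hne, mul_div_cancel_right₀ _ ha2]

lemma injOn_mob (hζ : ‖ζ‖ = 1) (ha : 0 ≤ a) (ha1 : a < 1) :
    InjOn (mob ζ a) (closedBall 0 1) := fun x hx y hy h => by
  rw [← mobInv_mob hζ ha ha1 (w := x) (by simpa using hx),
    ← mobInv_mob hζ ha ha1 (w := y) (by simpa using hy), h]

lemma SmoothOnDisk.comp_mob {f : ℂ → ℝ} (hf : SmoothOnDisk f) (hζ : ‖ζ‖ = 1) (ha : 0 ≤ a)
    (ha1 : a < 1) : SmoothOnDisk fun w => f (mob ζ a w) := fun w hw =>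
  (hf _ (norm_mob_le hζ ha ha1 hw)).comp w (contDiffAt_mob ha ha1 hw)

lemma abs_det_restrictScalars_toSpanSingleton (c : ℂ) :
    |((ContinuousLinearMap.toSpanSingleton ℂ c).restrictScalars ℝ : ℂ →L[ℝ] ℂ).det| =
      ‖c‖ ^ 2 := by
  simp [ContinuousLinearMap.det, LinearMap.det_restrictScalars, Algebra.norm_complex_eq,
    Complex.normSq_eq_norm_sq]

lemma measurableSet_image_mob (hζ : ‖ζ‖ = 1) (ha : 0 ≤ a) (ha1 : a < 1) {U : Set ℂ}
    (hU : MeasurableSet U) (hU1 : U ⊆ closedBall 0 1) : MeasurableSet (mob ζ a '' U) :=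
  hU.image_of_continuousOn_injOn
    (fun w hw => (hasDerivAt_mob ha ha1
      (by simpa using hU1 hw)).continuousAt.continuousWithinAt)
    ((injOn_mob hζ ha ha1).mono hU1)

/-- The Dirichlet energy does not increase under the conformal pullback by `mob ζ a`. -/
lemma lintegral_energy_comp_mob_le {f : ℂ → ℝ} (hf : SmoothOnDisk f) (hζ : ‖ζ‖ = 1) (ha : 0 ≤ a)
    (ha1 : a < 1) {U : Set ℂ} (hU : MeasurableSet U) (hU1 : U ⊆ closedBall 0 1) :
    ∫⁻ z in U, (‖fderiv ℝ (fun w => f (mob ζ a w)) z‖₊ : ℝ≥0∞) ^ 2 ≤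
      ∫⁻ z in mob ζ a '' U, (‖fderiv ℝ f z‖₊ : ℝ≥0∞) ^ 2 := by
  have hn : ∀ w ∈ U, ‖w‖ ≤ 1 := fun w hw => by simpa using hU1 hw
  have hd : ∀ w ∈ U, HasFDerivAt (mob ζ a) ((ContinuousLinearMap.toSpanSingleton ℂ
      (ζ * ((1 - a ^ 2) / (1 + a * w) ^ 2))).restrictScalars ℝ : ℂ →L[ℝ] ℂ) w := fun w hw =>
    (hasDerivAt_mob ha ha1 (hn w hw)).hasFDerivAt.restrictScalars ℝ
  rw [lintegral_image_eq_lintegral_abs_det_fderiv_mul volume hU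
    (fun w hw => (hd w hw).hasFDerivWithinAt) ((injOn_mob hζ ha ha1).mono hU1)]
  refine setLIntegral_mono' hU fun w hw => ?_
  rw [abs_det_restrictScalars_toSpanSingleton]
  have hc := ((hf.hasFDerivAt (norm_mob_le hζ ha ha1 (hn w hw))).comp w (hd w hw)).fderiv
  have hc' : fderiv ℝ (fun w => f (mob ζ a w)) w = _ := hc
  rw [hc', ENNReal.ofReal_pow (norm_nonneg _), ofReal_norm, ← mul_pow]
  gcongr
  rw [mul_comm ‖_‖ₑ]
  simp only [enorm_eq_nnnorm]
  norm_cast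
  refine (ContinuousLinearMap.opNNNorm_comp_le _ _).trans ?_
  gcongr
  refine ContinuousLinearMap.opNNNorm_le_bound _ _ fun x => ?_
  simp [mul_comm]

/-- The argument of `mob 1 a (circPt θ)`. -/
def mobArg (a θ : ℝ) : ℝ := θ - 2 * (Complex.log (1 + a * circPt θ)).im

lemma one_add_mul_mem_slitPlane (ha : 0 ≤ a) (ha1 : a < 1) (θ : ℝ) :
    1 + (a : ℂ) * circPt θ ∈ Complex.slitPlane := by
  left
  have h := Complex.abs_re_le_norm ((a : ℂ) * circPt θ)
  rw [norm_smul_circPt, abs_of_nonneg ha, abs_le] at h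
  simp only [Complex.add_re, Complex.one_re]
  linarith [h.1]

lemma mob_circPt (ha : 0 ≤ a) (ha1 : a < 1) (θ : ℝ) :
    mob ζ a (circPt θ) = ζ * circPt (mobArg a θ) := by
  have hne := one_add_mul_ne_zero ha ha1 (norm_circPt θ).le
  set u := 1 + (a : ℂ) * circPt θ with hu
  have hw : circPt θ * (starRingEnd ℂ) (circPt θ) = 1 := by
    rw [Complex.mul_conj, Complex.normSq_eq_norm_sq, norm_circPt]; simp
  have h1 : circPt θ + a = circPt θ * (starRingEnd ℂ) u := by
    rw [hu]; simp only [map_add, map_one, map_mul, Complex.conj_ofReal]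
    linear_combination (-(a : ℂ)) * hw
  have hcu : (starRingEnd ℂ) u / u = Complex.exp (-2 * (Complex.log u).im * Complex.I) := by
    have h2 : (starRingEnd ℂ) u = Complex.exp ((starRingEnd ℂ) (Complex.log u)) := by
      rw [Complex.exp_conj, Complex.exp_log hne]
    rw [h2]
    nth_rw 2 [← Complex.exp_log hne]
    rw [← Complex.exp_sub]
    congr 1
    apply Complex.ext <;> simp
    ring
  rw [mob, ← hu, h1, mul_div_assoc, hcu, mobArg, ← hu]
  simp only [circPt, ← Complex.exp_add]
  congr 2
  push_cast
  ring

lemma hasDerivAt_mobArg (ha : 0 ≤ a) (ha1 : a < 1) (θ : ℝ) :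
    HasDerivAt (mobArg a) ((1 - a ^ 2) / ‖1 + a * circPt θ‖ ^ 2) θ := by
  have hne := one_add_mul_ne_zero ha ha1 (norm_circPt θ).le
  have h1 : HasDerivAt (fun θ : ℝ => 1 + (a : ℂ) * circPt θ) (a * (circPt θ * Complex.I)) θ :=
    ((hasDerivAt_circPt θ).const_mul (a : ℂ)).const_add 1
  have h2 := h1.clog_real (one_add_mul_mem_slitPlane ha ha1 θ)
  have h3 := (Complex.imCLM.hasFDerivAt.comp_hasDerivAt θ h2)
  have h4 := (hasDerivAt_id θ).sub (h3.const_mul 2)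
  refine h4.congr_deriv ?_
  have hw : (circPt θ).re ^ 2 + (circPt θ).im ^ 2 = 1 := by
    have := norm_circPt θ
    rw [← Complex.sq_norm_sub_sq_re (circPt θ), this]; ring
  have hn : ‖1 + (a : ℂ) * circPt θ‖ ^ 2 = 1 + 2 * a * (circPt θ).re + a ^ 2 := by
    rw [← Complex.normSq_eq_norm_sq, Complex.normSq_apply]
    simp
    linear_combination a ^ 2 * hw
  have hpos : 0 < ‖1 + (a : ℂ) * circPt θ‖ ^ 2 := by positivity
  have him : (Complex.imCLM ((a : ℂ) * (circPt θ * Complex.I) / (1 + a * circPt θ))) =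
      (a * (circPt θ).re + a ^ 2) / ‖1 + (a : ℂ) * circPt θ‖ ^ 2 := by
    rw [Complex.imCLM_apply, Complex.div_im, ← Complex.normSq_eq_norm_sq, ← sub_div]
    congr 1
    simp
    linear_combination a ^ 2 * hw
  rw [him, eq_div_iff hpos.ne', sub_mul, mul_assoc, div_mul_cancel₀ _ hpos.ne', hn]
  ring

lemma deriv_mobArg_pos (ha : 0 ≤ a) (ha1 : a < 1) (θ : ℝ) :
    0 < (1 - a ^ 2) / ‖1 + a * circPt θ‖ ^ 2 := by
  have hne := one_add_mul_ne_zero ha ha1 (norm_circPt θ).le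
  have : 0 < 1 - a ^ 2 := by nlinarith
  positivity

lemma strictMono_mobArg (ha : 0 ≤ a) (ha1 : a < 1) : StrictMono (mobArg a) :=
  strictMono_of_deriv_pos fun θ => by
    rw [(hasDerivAt_mobArg ha ha1 θ).deriv]; exact deriv_mobArg_pos ha ha1 θ

lemma mobArg_pi (ha1 : a < 1) : mobArg a Real.pi = Real.pi := by
  have : 1 + (a : ℂ) * circPt Real.pi = ((1 - a : ℝ) : ℂ) := by
    rw [circPt, Complex.exp_pi_mul_I]; push_cast; ring
  rw [mobArg, this, Complex.log_im, Complex.arg_ofReal_of_nonneg (by linarith)]; ring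

lemma mobArg_neg_pi (ha1 : a < 1) : mobArg a (-Real.pi) = -Real.pi := by
  have : 1 + (a : ℂ) * circPt (-Real.pi) = ((1 - a : ℝ) : ℂ) := by
    rw [circPt, Complex.ofReal_neg, neg_mul, Complex.exp_neg, Complex.exp_pi_mul_I]
    push_cast; norm_num; ring
  rw [mobArg, this, Complex.log_im, Complex.arg_ofReal_of_nonneg (by linarith)]; ring

lemma image_mobArg (ha : 0 ≤ a) (ha1 : a < 1) :
    mobArg a '' Ioo (-Real.pi) Real.pi = Ioo (-Real.pi) Real.pi := by
  have hc : Continuous (mobArg a) :=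
    continuous_iff_continuousAt.2 fun θ => (hasDerivAt_mobArg ha ha1 θ).continuousAt
  refine Subset.antisymm ?_ ?_
  · rintro _ ⟨θ, hθ, rfl⟩
    have h1 := strictMono_mobArg ha ha1 hθ.1
    have h2 := strictMono_mobArg ha ha1 hθ.2
    rw [mobArg_neg_pi ha1] at h1
    rw [mobArg_pi ha1] at h2
    exact ⟨h1, h2⟩
  · have := intermediate_value_Ioo (f := mobArg a) (by linarith [Real.pi_pos] :
      -Real.pi ≤ Real.pi) hc.continuousOn
    rwa [mobArg_pi ha1, mobArg_neg_pi ha1] at this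

lemma lintegral_comp_mobArg (ha : 0 ≤ a) (ha1 : a < 1) (G : ℝ → ℝ≥0∞) :
    ∫⁻ θ in Ioo (-Real.pi) Real.pi, G θ = ∫⁻ θ in Ioo (-Real.pi) Real.pi,
      ENNReal.ofReal ((1 - a ^ 2) / ‖1 + a * circPt θ‖ ^ 2) * G (mobArg a θ) := by
  rw [← image_mobArg ha ha1, lintegral_image_eq_lintegral_abs_deriv_mul measurableSet_Ioo
    (fun θ _ => (hasDerivAt_mobArg ha ha1 θ).hasDerivWithinAt)
    (strictMono_mobArg ha ha1).injective.injOn, image_mobArg ha ha1]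
  refine lintegral_congr fun θ => ?_
  rw [abs_of_pos (deriv_mobArg_pos ha ha1 θ)]

end Mob


/-! ### The length measure on the unit circle -/

lemma lipschitzWith_circPt : LipschitzWith 1 circPt :=
  lipschitzWith_of_nnnorm_deriv_le (fun θ => (hasDerivAt_circPt θ).differentiableAt) fun θ => by
    rw [(hasDerivAt_circPt θ).deriv, ← NNReal.coe_le_coe]
    simp [norm_circPt]

lemma exists_circPt_eq {z : ℂ} (hz : ‖z‖ = 1) : circPt z.arg = z := by
  have := Complex.norm_mul_exp_arg_mul_I z
  rw [hz] at this
  simpa [circPt] using this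

lemma hausdorffMeasure_sphere_lt_top : μH[1] (sphere (0 : ℂ) 1) < ∞ := by
  have h1 : sphere (0 : ℂ) 1 ⊆ circPt '' Icc (-Real.pi) Real.pi := fun z hz =>
    ⟨z.arg, ⟨(Complex.neg_pi_lt_arg z).le, Complex.arg_le_pi z⟩,
      exists_circPt_eq (by simpa using hz)⟩
  refine (measure_mono h1).trans_lt (((lipschitzWith_circPt).hausdorffMeasure_image_le
    zero_le_one _).trans_lt ?_)
  rw [hausdorffMeasure_real, Real.volume_Icc]
  simp

lemma hausdorffMeasure_sphere_pos : 0 < μH[1] (sphere (0 : ℂ) 1) := by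
  have hl : LipschitzWith 1 Complex.re :=
    LipschitzWith.of_dist_le_mul fun x y => by
      rw [NNReal.coe_one, one_mul, Real.dist_eq, ← Complex.sub_re, dist_eq_norm]
      exact Complex.abs_re_le_norm _
  have h := hl.hausdorffMeasure_image_le zero_le_one (sphere (0 : ℂ) 1)
  have h2 : Icc (-1 : ℝ) 1 ⊆ Complex.re '' sphere (0 : ℂ) 1 := fun x hx => by
    refine ⟨circPt (Real.arccos x), by simp [norm_circPt], ?_⟩
    rw [circPt, Complex.exp_ofReal_mul_I_re, Real.cos_arccos hx.1 hx.2]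
  have h3 := (measure_mono h2).trans h
  rw [hausdorffMeasure_real, Real.volume_Icc] at h3
  norm_num at h3
  exact lt_of_lt_of_le (by norm_num) h3

/-- The embedding of `ℝ / 2πℤ` in the plane as the unit circle. -/
def circEmb (x : AddCircle (2 * Real.pi)) : ℂ := (AddCircle.toCircle x : ℂ)

lemma circEmb_coe (θ : ℝ) : circEmb (θ : AddCircle (2 * Real.pi)) = circPt θ := by
  have : (2 * Real.pi) ≠ 0 := by positivity
  rw [circEmb, AddCircle.toCircle_apply_mk, div_self this, one_mul, Circle.coe_exp, circPt]

lemma circEmb_add (x y : AddCircle (2 * Real.pi)) : circEmb (x + y) = circEmb x * circEmb y := by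
  simp [circEmb, AddCircle.toCircle_add]

lemma norm_circEmb (x : AddCircle (2 * Real.pi)) : ‖circEmb x‖ = 1 :=
  Circle.norm_coe _

instance fact_two_pi_pos : Fact (0 < 2 * Real.pi) := ⟨by positivity⟩

lemma measurableEmbedding_circEmb : MeasurableEmbedding circEmb := by
  have hc : Continuous circEmb := continuous_subtype_val.comp AddCircle.continuous_toCircle
  have hi : Function.Injective circEmb := fun x y h =>
    AddCircle.injective_toCircle (by positivity) (Subtype.ext h)
  exact (hc.isClosedEmbedding hi).measurableEmbedding

lemma range_circEmb : range circEmb = sphere (0 : ℂ) 1 := by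
  ext z
  constructor
  · rintro ⟨x, rfl⟩; simp [norm_circEmb]
  · intro hz
    exact ⟨(z.arg : AddCircle (2 * Real.pi)),
      by rw [circEmb_coe, exists_circPt_eq (by simpa using hz)]⟩

lemma hausdorffMeasure_image_mul {u : ℂ} (hu : ‖u‖ = 1) (S : Set ℂ) :
    μH[1] ((fun z => u * z) '' S) = μH[1] S := by
  have : Isometry fun z : ℂ => u * z := Isometry.of_dist_eq fun x y => by
    rw [dist_eq_norm, dist_eq_norm, ← mul_sub, norm_mul, hu, one_mul]
  exact this.hausdorffMeasure_image (Or.inl zero_le_one) S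

lemma comap_circEmb_isAddLeftInvariant :
    ((μH[1] : Measure ℂ).comap circEmb).IsAddLeftInvariant := by
  have he := measurableEmbedding_circEmb
  refine ⟨fun x => ?_⟩
  ext S hS
  rw [Measure.map_apply (measurable_const_add x) hS, he.comap_apply, he.comap_apply,
    ← hausdorffMeasure_image_mul (norm_circEmb x)]
  congr 1
  ext z
  simp only [mem_image, mem_preimage]
  constructor
  · rintro ⟨_, ⟨y, hy, rfl⟩, rfl⟩
    exact ⟨x + y, hy, circEmb_add x y⟩
  · rintro ⟨y, hy, rfl⟩
    exact ⟨_, ⟨-x + y, by simpa using hy, rfl⟩, by rw [← circEmb_add]; simp⟩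

/-- Length on the unit circle is a constant multiple of the angular measure. -/
lemma exists_lintegral_circle_eq : ∃ c : ℝ≥0∞, c ≠ 0 ∧ c ≠ ∞ ∧ ∀ G : ℂ → ℝ≥0∞, Measurable G →
    ∫⁻ z in sphere (0 : ℂ) 1, G z ∂μH[1] =
      c * ∫⁻ θ in Ioo (-Real.pi) Real.pi, G (circPt θ) := by
  have he := measurableEmbedding_circEmb
  set ν := (μH[1] : Measure ℂ).comap circEmb with hν
  have : ν.IsAddLeftInvariant := comap_circEmb_isAddLeftInvariant
  have hu : ν univ = μH[1] (sphere (0 : ℂ) 1) := by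
    rw [hν, he.comap_apply, image_univ, range_circEmb]
  have : IsFiniteMeasure ν := ⟨hu ▸ hausdorffMeasure_sphere_lt_top⟩
  have hsm := Measure.isAddLeftInvariant_eq_smul ν (volume : Measure (AddCircle (2 * Real.pi)))
  set c := ν.addHaarScalarFactor (volume : Measure (AddCircle (2 * Real.pi)))
  refine ⟨c, ?_, ENNReal.coe_ne_top, fun G hG => ?_⟩
  · intro h0
    have h1 : c = 0 := by exact_mod_cast h0
    rw [h1, zero_smul] at hsm
    have := hausdorffMeasure_sphere_pos
    rw [← hu, hsm] at this
    simp at this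
  · rw [← range_circEmb, ← he.map_comap, he.lintegral_map, ← hν, hsm, lintegral_smul_measure,
      ← AddCircle.lintegral_preimage (2 * Real.pi) (-Real.pi)]
    simp only [circEmb_coe]
    rw [show -Real.pi + 2 * Real.pi = Real.pi by ring, restrict_Ioo_eq_restrict_Ioc]
    rfl

lemma lintegral_circle_mul {u : ℂ} (hu : ‖u‖ = 1) (G : ℂ → ℝ≥0∞) :
    ∫⁻ z in sphere (0 : ℂ) 1, G z ∂μH[1] = ∫⁻ z in sphere (0 : ℂ) 1, G (u * z) ∂μH[1] := by
  set e : ℂ ≃ₗᵢ[ℝ] ℂ := rotation ⟨u, by simpa [Submonoid.unitSphere] using hu⟩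
  have hm := e.toIsometryEquiv.measurePreserving_hausdorffMeasure 1
  have h := hm.setLIntegral_comp_preimage_emb
    e.toHomeomorph.measurableEmbedding G (sphere 0 1)
  rw [← h]
  have : e.toIsometryEquiv ⁻¹' sphere (0 : ℂ) 1 = sphere 0 1 := by
    ext z; simp
  rw [this]
  rfl


/-! ### Weights concentrating on images of the circle -/

/-- The angles in `(-π, π)` of the points of the unit circle lying in `B`. -/
def arcs (B : Set ℂ) : Set ℝ := {θ ∈ Ioo (-Real.pi) Real.pi | circPt θ ∈ B}

lemma arcs_subset (B : Set ℂ) : arcs B ⊆ Ioo (-Real.pi) Real.pi := fun _ h => h.1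

lemma measurableSet_arcs {B : Set ℂ} (hB : MeasurableSet B) : MeasurableSet (arcs B) :=
  measurableSet_Ioo.inter (continuous_circPt.measurable hB)

/-- The disk of radius `r` together with the part of the unit disk over the arcs in `B`. -/
def arcRegion (r : ℝ) (B : Set ℂ) : Set ℂ := {z | ‖z‖ < r ∨ ‖z‖ < 1 ∧ z.arg ∈ arcs B}

lemma measurableSet_arcRegion (r : ℝ) {B : Set ℂ} (hB : MeasurableSet B) :
    MeasurableSet (arcRegion r B) :=
  (measurableSet_lt measurable_norm measurable_const).union
    ((measurableSet_lt measurable_norm measurable_const).inter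
      (Complex.measurable_arg (measurableSet_arcs hB)))

lemma arcRegion_subset {r : ℝ} (hr : r < 1) (B : Set ℂ) : arcRegion r B ⊆ ball 0 1 := by
  rintro z (h | h)
  · simpa using h.trans hr
  · simpa using h.1

open Classical in
/-- The density of the image under `mob ζ a` of the length measure on the part of the unit circle
in `B`. -/
def bubble (ζ : ℂ) (a : ℝ) (B : Set ℂ) (z : ℂ) : ℝ :=
  if mobInv ζ a z ∈ B then ‖1 + a * mobInv ζ a z‖ ^ 2 / (1 - a ^ 2) else 0

section Bubble

variable {ζ : ℂ} {a : ℝ} {B : Set ℂ}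

lemma measurable_mobInv : Measurable (mobInv ζ a) := by unfold mobInv; fun_prop

lemma measurable_bubble (hB : MeasurableSet B) : Measurable (bubble ζ a B) := by
  have := measurable_mobInv (ζ := ζ) (a := a)
  unfold bubble
  exact Measurable.ite (this hB) (by fun_prop) measurable_const

lemma bubble_nonneg (ha : 0 ≤ a) (ha1 : a < 1) (z : ℂ) : 0 ≤ bubble ζ a B z := by
  have : 0 < 1 - a ^ 2 := by nlinarith
  unfold bubble
  split_ifs <;> positivity

lemma norm_mobInv_le (hζ : ‖ζ‖ = 1) {z : ℂ} (hz : ‖z‖ = 1) :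
    ‖mobInv ζ a z‖ ≤ 1 := by
  have h1 : ‖ζ⁻¹ * z‖ = 1 := by rw [norm_mul, norm_inv, hζ, hz]; simp
  have h := normSq_add_identity (-a) (ζ⁻¹ * z)
  rw [h1] at h
  push_cast at h
  rw [neg_mul, ← sub_eq_add_neg, ← sub_eq_add_neg] at h
  rw [mobInv, norm_div]
  refine div_le_one_of_le₀ (le_of_sq_le_sq ?_ (norm_nonneg _)) (norm_nonneg _)
  linarith

lemma bubble_le (hζ : ‖ζ‖ = 1) (ha : 0 ≤ a) (ha1 : a < 1) {z : ℂ} (hz : ‖z‖ = 1) :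
    bubble ζ a B z ≤ 4 / (1 - a ^ 2) := by
  have h1 : 0 < 1 - a ^ 2 := by nlinarith
  unfold bubble
  split_ifs
  · gcongr
    have h2 : ‖1 + (a : ℂ) * mobInv ζ a z‖ ≤ 2 := by
      refine (norm_add_le _ _).trans ?_
      rw [norm_mul, Complex.norm_real, Real.norm_of_nonneg ha, norm_one]
      nlinarith [norm_mobInv_le (a := a) hζ hz, norm_nonneg (mobInv ζ a z)]
    nlinarith [norm_nonneg (1 + (a : ℂ) * mobInv ζ a z)]
  · positivity

lemma bubble_mul (u z : ℂ) : bubble ζ a B (u * z) = bubble (u⁻¹ * ζ) a B z := by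
  have : mobInv ζ a (u * z) = mobInv (u⁻¹ * ζ) a z := by
    rw [mobInv, mobInv, mul_inv, inv_inv, ← mul_assoc, mul_comm u]
  rw [bubble, bubble, this]

lemma bubble_mob_circPt (hζ : ‖ζ‖ = 1) (ha : 0 ≤ a) (ha1 : a < 1) {θ : ℝ}
    (hθ : θ ∈ Ioo (-Real.pi) Real.pi) :
    ENNReal.ofReal ((1 - a ^ 2) / ‖1 + a * circPt θ‖ ^ 2) *
      ENNReal.ofReal (bubble ζ a B (mob ζ a (circPt θ))) = (arcs B).indicator 1 θ := by
  have h1 : 1 - a ^ 2 ≠ 0 := by nlinarith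
  have h2 := one_add_mul_ne_zero ha ha1 (norm_circPt θ).le
  rw [← ENNReal.ofReal_mul (deriv_mobArg_pos ha ha1 θ).le, bubble,
    mobInv_mob hζ ha ha1 (norm_circPt θ).le]
  by_cases h : circPt θ ∈ B
  · rw [if_pos h, indicator_of_mem (show θ ∈ arcs B from ⟨hθ, h⟩),
      div_mul_div_cancel₀ (by simpa using h2), div_self h1]
    simp
  · rw [if_neg h, indicator_of_notMem (fun h' : θ ∈ arcs B => h h'.2)]
    simp

lemma lintegral_bubble {c : ℝ≥0∞} (hc : ∀ G : ℂ → ℝ≥0∞, Measurable G →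
      ∫⁻ z in sphere (0 : ℂ) 1, G z ∂μH[1] =
        c * ∫⁻ θ in Ioo (-Real.pi) Real.pi, G (circPt θ))
    (hζ : ‖ζ‖ = 1) (ha : 0 ≤ a) (ha1 : a < 1) (hB : MeasurableSet B) {G : ℂ → ℝ≥0∞}
    (hG : Measurable G) :
    ∫⁻ z in sphere (0 : ℂ) 1, ENNReal.ofReal (bubble ζ a B z) * G z ∂μH[1] =
      c * ∫⁻ θ in arcs B, G (mob ζ a (circPt θ)) := by
  have hm : Measurable fun z => ENNReal.ofReal (bubble ζ a B z) * G z :=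
    (measurable_bubble hB).ennreal_ofReal.mul hG
  have hm' : Measurable fun z => ENNReal.ofReal (bubble ζ a B (ζ * z)) * G (ζ * z) :=
    hm.comp (measurable_const_mul ζ)
  rw [lintegral_circle_mul hζ, hc _ hm',
    lintegral_comp_mobArg ha ha1]
  congr 1
  have hA := measurableSet_arcs hB
  rw [← inter_eq_self_of_subset_left (arcs_subset B), ← Measure.restrict_restrict hA,
    ← lintegral_indicator hA]
  refine setLIntegral_congr_fun measurableSet_Ioo fun θ hθ => ?_
  rw [← mob_circPt ha ha1, ← mul_assoc, bubble_mob_circPt hζ ha ha1 hθ]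
  by_cases h : θ ∈ arcs B <;> simp [h]

end Bubble

/-- Finitely many automorphisms of the disk taking prescribed regions to disjoint regions. -/
structure BubbleSystem (ι : Type*) where
  ζ : ι → ℂ
  a : ι → ℝ
  B : ι → Set ℂ
  r : ℝ
  norm_ζ : ∀ i, ‖ζ i‖ = 1
  a_nonneg : ∀ i, 0 ≤ a i
  a_lt : ∀ i, a i < 1
  measurableSet_B : ∀ i, MeasurableSet (B i)
  r_pos : 0 < r
  r_lt : r < 1
  disjoint : Pairwise fun i j =>
    Disjoint (mob (ζ i) (a i) '' arcRegion r (B i)) (mob (ζ j) (a j) '' arcRegion r (B j))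

namespace BubbleSystem

variable {ι : Type*} [Fintype ι] (S : BubbleSystem ι)

/-- The total weight of a system. -/
def weight (z : ℂ) : ℝ := ∑ i, bubble (S.ζ i) (S.a i) (S.B i) z

lemma weight_nonneg (z : ℂ) : 0 ≤ S.weight z :=
  Finset.sum_nonneg fun i _ => bubble_nonneg (S.a_nonneg i) (S.a_lt i) z

lemma measurable_weight : Measurable S.weight :=
  Finset.measurable_sum _ fun i _ => measurable_bubble (S.measurableSet_B i)

lemma weight_le {z : ℂ} (hz : ‖z‖ = 1) : S.weight z ≤ ∑ i, 4 / (1 - S.a i ^ 2) :=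
  Finset.sum_le_sum fun i _ => bubble_le (S.norm_ζ i) (S.a_nonneg i) (S.a_lt i) hz

lemma lintegral_weight {c : ℝ≥0∞} (hc : ∀ G : ℂ → ℝ≥0∞, Measurable G →
      ∫⁻ z in sphere (0 : ℂ) 1, G z ∂μH[1] =
        c * ∫⁻ θ in Ioo (-Real.pi) Real.pi, G (circPt θ))
    {G : ℂ → ℝ≥0∞} (hG : Measurable G) :
    ∫⁻ z in sphere (0 : ℂ) 1, ENNReal.ofReal (S.weight z) * G z ∂μH[1] =
      c * ∑ i, ∫⁻ θ in arcs (S.B i), G (mob (S.ζ i) (S.a i) (circPt θ)) := by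
  simp only [weight]
  rw [Finset.mul_sum]
  simp only [← lintegral_bubble hc (S.norm_ζ _) (S.a_nonneg _) (S.a_lt _) (S.measurableSet_B _) hG]
  have hm : ∀ i, Measurable fun z =>
      ENNReal.ofReal (bubble (S.ζ i) (S.a i) (S.B i) z) * G z := fun i =>
    (measurable_bubble (S.measurableSet_B i)).ennreal_ofReal.mul hG
  rw [← lintegral_finsetSum _ fun i _ => hm i]
  refine lintegral_congr fun z => ?_
  rw [ENNReal.ofReal_sum_of_nonneg fun i _ => bubble_nonneg (S.a_nonneg i) (S.a_lt i) z,
    Finset.sum_mul]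

lemma sum_lintegral_arcs_le {f : ℂ → ℝ} (hf : SmoothOnDisk f)
    (hmean : ∀ i, ∫ θ in -Real.pi..Real.pi, f (mob (S.ζ i) (S.a i) (S.r * circPt θ)) = 0) :
    ∑ i, ∫⁻ θ in arcs (S.B i), ENNReal.ofReal (f (mob (S.ζ i) (S.a i) (circPt θ)) ^ 2) ≤
      ENNReal.ofReal (1 / S.r) * ∫⁻ z in ball (0 : ℂ) 1, (‖fderiv ℝ f z‖₊ : ℝ≥0∞) ^ 2 := by
  have hsub : ∀ i, arcRegion S.r (S.B i) ⊆ ball 0 1 := fun i => arcRegion_subset S.r_lt _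
  have hsub' : ∀ i, arcRegion S.r (S.B i) ⊆ closedBall 0 1 := fun i =>
    (hsub i).trans ball_subset_closedBall
  have hm : ∀ i, MeasurableSet (arcRegion S.r (S.B i)) := fun i =>
    measurableSet_arcRegion _ (S.measurableSet_B i)
  have h1 : ∀ i, ∫⁻ θ in arcs (S.B i),
      ENNReal.ofReal (f (mob (S.ζ i) (S.a i) (circPt θ)) ^ 2) ≤ ENNReal.ofReal (1 / S.r) *
      ∫⁻ z in mob (S.ζ i) (S.a i) '' arcRegion S.r (S.B i), (‖fderiv ℝ f z‖₊ : ℝ≥0∞) ^ 2 :=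
    fun i => ((hf.comp_mob (S.norm_ζ i) (S.a_nonneg i) (S.a_lt i)).lintegral_arc_le S.r_pos
      S.r_lt (measurableSet_arcs (S.measurableSet_B i)) (arcs_subset _) (hmean i)).trans
      (mul_le_mul_right (lintegral_energy_comp_mob_le hf (S.norm_ζ i) (S.a_nonneg i) (S.a_lt i)
        (hm i) (hsub' i)) _)
  refine (Finset.sum_le_sum fun i _ => h1 i).trans ?_
  rw [← Finset.mul_sum]
  gcongr
  rw [← tsum_fintype (L := .unconditional _), ← lintegral_iUnion
    (fun i => measurableSet_image_mob (S.norm_ζ i) (S.a_nonneg i) (S.a_lt i) (hm i) (hsub' i))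
    S.disjoint]
  refine lintegral_mono_set (iUnion_subset fun i => ?_)
  rintro _ ⟨w, hw, rfl⟩
  have := hsub i hw
  simp only [mem_ball, dist_zero_right] at this ⊢
  exact norm_mob_lt (S.norm_ζ i) (S.a_nonneg i) (S.a_lt i) this

end BubbleSystem


/-! ### Lower bound for the weighted Steklov eigenvalues of the disk -/

/-- The standard isometry from the complex plane to the Euclidean plane. -/
def toE2 : ℂ ≃ₗᵢ[ℝ] E2 := Complex.orthonormalBasisOneI.repr

lemma toE2_apply_zero (z : ℂ) : toE2 z 0 = z.re := by
  simp [toE2, Complex.orthonormalBasisOneI]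

lemma toE2_apply_one (z : ℂ) : toE2 z 1 = z.im := by
  simp [toE2, Complex.orthonormalBasisOneI]

lemma rotBy_toE2 (θ : ℝ) (z : ℂ) : rotBy θ (toE2 z) = toE2 (circPt θ * z) := by
  ext i
  fin_cases i
  · simp [rotBy, toE2_apply_zero, toE2_apply_one, circPt, Complex.exp_ofReal_mul_I_re,
      Complex.exp_ofReal_mul_I_im]
  · simp [rotBy, toE2_apply_zero, toE2_apply_one, circPt, Complex.exp_ofReal_mul_I_re,
      Complex.exp_ofReal_mul_I_im]
    ring

lemma frontier_ball_E2 : frontier (ball (0 : E2) 1) = sphere 0 1 := frontier_ball _ one_ne_zero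

lemma lintegral_sphere_E2 (G : E2 → ℝ≥0∞) :
    ∫⁻ x in sphere (0 : E2) 1, G x ∂μH[1] = ∫⁻ z in sphere (0 : ℂ) 1, G (toE2 z) ∂μH[1] := by
  have h := (toE2.toIsometryEquiv.measurePreserving_hausdorffMeasure 1).setLIntegral_comp_preimage_emb
    toE2.toHomeomorph.measurableEmbedding G (sphere 0 1)
  rw [← h]
  have : toE2.toIsometryEquiv ⁻¹' sphere (0 : E2) 1 = sphere 0 1 := by ext z; simp
  rw [this]
  rfl

lemma dirEnergy_ball (f : E2 → ℝ) : dirEnergy (ball 0 1) f =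
    ∫⁻ z in ball (0 : ℂ) 1, (‖fderiv ℝ (fun z => f (toE2 z)) z‖₊ : ℝ≥0∞) ^ 2 := by
  have h := toE2.measurePreserving.setLIntegral_comp_preimage_emb
    toE2.toHomeomorph.measurableEmbedding (fun x => (‖fderiv ℝ f x‖₊ : ℝ≥0∞) ^ 2) (ball 0 1)
  have hb : toE2 ⁻¹' ball (0 : E2) 1 = ball 0 1 := by ext z; simp
  rw [dirEnergy, ← h, hb]
  refine lintegral_congr fun z => ?_
  have h1 : fderiv ℝ (fun z => f (toE2 z)) z =
      (fderiv ℝ f (toE2 z)).comp (toE2.toContinuousLinearEquiv : ℂ →L[ℝ] E2) :=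
    toE2.toContinuousLinearEquiv.comp_right_fderiv
  have h2 : ‖fderiv ℝ (fun z => f (toE2 z)) z‖₊ = ‖fderiv ℝ f (toE2 z)‖₊ := by
    rw [h1]
    exact Subtype.ext (ContinuousLinearMap.opNorm_comp_linearIsometryEquiv _ toE2)
  rw [h2]

lemma dirEnergy_ball_ne_top {f : E2 → ℝ} (hf : ContDiff ℝ 1 f) :
    dirEnergy (ball 0 1) f ≠ ∞ := by
  obtain ⟨C, hC⟩ := (isCompact_closedBall (0 : E2) 1).exists_bound_of_continuousOn
    (hf.continuous_fderiv one_ne_zero).continuousOn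
  refine ne_top_of_le_ne_top (b := ENNReal.ofReal C ^ 2 * volume (ball (0 : E2) 1))
    (ENNReal.mul_ne_top (by simp) measure_ball_lt_top.ne) ?_
  rw [dirEnergy, ← setLIntegral_const]
  refine setLIntegral_mono' measurableSet_ball fun x hx => ?_
  gcongr
  rw [← enorm_eq_nnnorm, ← ofReal_norm]
  exact ENNReal.ofReal_le_ofReal (hC x (ball_subset_closedBall hx))

lemma eqOn_const_of_dirEnergy_eq_zero {f : E2 → ℝ} (hf : ContDiff ℝ 1 f)
    (h : dirEnergy (ball 0 1) f = 0) : EqOn f (fun _ => f 0) (closedBall 0 1) := by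
  have hc : Continuous fun x => (‖fderiv ℝ f x‖₊ : ℝ≥0∞) ^ 2 := by
    have := hf.continuous_fderiv one_ne_zero
    fun_prop
  have h1 : EqOn (fderiv ℝ f) 0 (ball 0 1) := by
    rw [dirEnergy, lintegral_eq_zero_iff hc.measurable] at h
    have h2 := Measure.eqOn_open_of_ae_eq h isOpen_ball hc.continuousOn continuousOn_const
    intro x hx
    simpa using h2 hx
  have h2 : EqOn f (fun _ => f 0) (ball 0 1) := fun x hx =>
    isOpen_ball.is_const_of_fderiv_eq_zero (convex_ball (0 : E2) 1).isPreconnected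
      (hf.differentiable one_ne_zero).differentiableOn h1 hx (mem_ball_self one_pos)
  have h3 := h2.closure hf.continuous continuous_const
  rwa [closure_ball _ one_ne_zero] at h3

namespace BubbleSystem

variable {ι : Type*} (S : BubbleSystem ι)

/-- The mean of a function over the image of the circle of radius `r`. -/
def mean (i : ι) (f : E2 → ℝ) : ℝ :=
  ∫ θ in -Real.pi..Real.pi, f (toE2 (mob (S.ζ i) (S.a i) (S.r * circPt θ)))

lemma norm_r_mul_circPt_le (θ : ℝ) : ‖(S.r : ℂ) * circPt θ‖ ≤ 1 := by
  rw [norm_smul_circPt, abs_of_pos S.r_pos]; exact S.r_lt.le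

lemma continuous_mob_circle (i : ι) :
    Continuous fun θ : ℝ => toE2 (mob (S.ζ i) (S.a i) (S.r * circPt θ)) := by
  refine toE2.continuous.comp (continuous_iff_continuousAt.2 fun θ => ?_)
  exact ContinuousAt.comp (f := fun θ : ℝ => (S.r : ℂ) * circPt θ)
    (hasDerivAt_mob (S.a_nonneg i) (S.a_lt i) (S.norm_r_mul_circPt_le θ)).continuousAt
    (by fun_prop : Continuous fun θ : ℝ => (S.r : ℂ) * circPt θ).continuousAt

variable [Fintype ι]

lemma exists_ne_zero_mean_eq_zero (V : Submodule ℝ (E2 → ℝ))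
    (hV : ∀ f ∈ V, Continuous f) (hdim : Fintype.card ι < Module.finrank ℝ V) :
    ∃ f ∈ V, f ≠ 0 ∧ ∀ i, S.mean i f = 0 := by
  have h_int : ∀ f ∈ V, ∀ i, IntervalIntegrable
      (fun θ => f (toE2 (mob (S.ζ i) (S.a i) (S.r * circPt θ)))) volume (-Real.pi) Real.pi :=
    fun f hf i => ((hV f hf).comp (S.continuous_mob_circle i)).intervalIntegrable _ _
  let L : V →ₗ[ℝ] (ι → ℝ) :=
    { toFun := fun f i => S.mean i f
      map_add' := fun f g => by
        ext i
        exact intervalIntegral.integral_add (h_int f f.2 i) (h_int g g.2 i)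
      map_smul' := fun c f => by
        ext i
        exact intervalIntegral.integral_const_mul _ _ }
  have : FiniteDimensional ℝ V := Module.finite_of_finrank_pos (by omega)
  have hker : LinearMap.ker L ≠ ⊥ := LinearMap.ker_ne_bot_of_finrank_lt (by simpa using hdim)
  obtain ⟨f, hf, hne⟩ := Submodule.exists_mem_ne_zero_of_ne_bot hker
  exact ⟨f, f.2, fun h => hne (Subtype.ext h), fun i => congrFun (LinearMap.mem_ker.1 hf) i⟩

/-- The weight of a system, as a function on the Euclidean plane. -/
def weightE2 (x : E2) : ℝ := S.weight (toE2.symm x)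

lemma steklovW_mul_Lweight_ge [Nonempty ι] {k : ℕ} (hk : Fintype.card ι ≤ k) :
    ENNReal.ofReal S.r * ∑ i, volume (arcs (S.B i)) ≤
      steklovW (ball 0 1) S.weightE2 k * Lweight (ball 0 1) S.weightE2 := by
  obtain ⟨c, hc0, hct, hc⟩ := exists_lintegral_circle_eq
  have hL : Lweight (ball 0 1) S.weightE2 = c * ∑ i, volume (arcs (S.B i)) := by
    have := S.lintegral_weight hc (G := fun _ => 1) measurable_const
    rw [Lweight, frontier_ball_E2, lintegral_sphere_E2]
    simpa [weightE2] using this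
  have hσ : ENNReal.ofReal S.r / c ≤ steklovW (ball 0 1) S.weightE2 k := by
    rw [steklovW, steklovMixed]
    refine le_iInf fun V => le_iInf fun hdim => le_iInf fun hsm => le_iInf fun _ =>
      le_iInf fun hinj => ?_
    obtain ⟨f, hfV, hf0, hmean⟩ := S.exists_ne_zero_mean_eq_zero V
      (fun f hf => (hsm f hf).continuous) (by omega)
    have hfs : ContDiff ℝ 1 f := (hsm f hfV).of_le (by exact_mod_cast le_top)
    have hne : ¬ EqOn f 0 (closure (ball 0 1)) := fun h => hf0 (hinj f hfV h)
    refine le_iSup₂_of_le f hfV (le_iSup_of_le hne ?_)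
    have hE0 : dirEnergy (ball 0 1) f ≠ 0 := by
      intro h
      have h1 := eqOn_const_of_dirEnergy_eq_zero hfs h
      have h2 : S.mean (Classical.arbitrary ι) f = 2 * Real.pi * f 0 := by
        have h3 : ∀ θ : ℝ, f (toE2 (mob (S.ζ (Classical.arbitrary ι))
            (S.a (Classical.arbitrary ι)) (S.r * circPt θ))) = f 0 := fun θ => h1 (by
          simpa using norm_mob_le (S.norm_ζ _) (S.a_nonneg _) (S.a_lt _)
            (S.norm_r_mul_circPt_le θ))
        rw [mean]
        simp only [h3, intervalIntegral.integral_const, smul_eq_mul]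
        ring
      rw [hmean] at h2
      have h3 : f 0 = 0 := by
        rcases mul_eq_zero.1 h2.symm with h | h
        · exact absurd h (by positivity)
        · exact h
      refine hne fun x hx => ?_
      rw [closure_ball _ one_ne_zero] at hx
      rw [h1 hx, h3]; rfl
    have hsmooth : SmoothOnDisk fun z => f (toE2 z) := fun w _ =>
      (hfs.comp toE2.contDiff).contDiffAt
    have hmeas : Measurable fun z => ENNReal.ofReal (f (toE2 z) ^ 2) :=
      ((hfs.continuous.comp toE2.continuous).pow 2).measurable.ennreal_ofReal
    have hB : bdryInt (frontier (ball 0 1)) S.weightE2 f =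
        ∫⁻ z in sphere (0 : ℂ) 1, ENNReal.ofReal (S.weight z) *
          ENNReal.ofReal (f (toE2 z) ^ 2) ∂μH[1] := by
      rw [bdryInt, frontier_ball_E2, lintegral_sphere_E2]
      refine lintegral_congr fun z => ?_
      rw [weightE2, LinearIsometryEquiv.symm_apply_apply, ENNReal.ofReal_mul (S.weight_nonneg z)]
    have hle := S.sum_lintegral_arcs_le hsmooth hmean
    rw [← dirEnergy_ball] at hle
    rw [S.lintegral_weight hc hmeas] at hB
    rw [rayleigh, ENNReal.le_div_iff_mul_le (Or.inr hE0) (Or.inr (dirEnergy_ball_ne_top hfs)), hB]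
    calc ENNReal.ofReal S.r / c * (c * ∑ i, ∫⁻ θ in arcs (S.B i),
          ENNReal.ofReal (f (toE2 (mob (S.ζ i) (S.a i) (circPt θ))) ^ 2))
        ≤ ENNReal.ofReal S.r / c * (c * (ENNReal.ofReal (1 / S.r) * dirEnergy (ball 0 1) f)) := by
          gcongr
      _ = dirEnergy (ball 0 1) f := by
          rw [← mul_assoc, ENNReal.div_mul_cancel hc0 hct, ← mul_assoc,
            ← ENNReal.ofReal_mul S.r_pos.le, mul_one_div_cancel S.r_pos.ne']
          simp
  calc ENNReal.ofReal S.r * ∑ i, volume (arcs (S.B i))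
      = ENNReal.ofReal S.r / c * (c * ∑ i, volume (arcs (S.B i))) := by
        rw [← mul_assoc, ENNReal.div_mul_cancel hc0 hct]
    _ ≤ _ := by rw [hL]; gcongr

end BubbleSystem


/-! ### Symmetric systems -/

/-- The points at distance more than `2 h` from all points of `Z`. -/
def farFrom (Z : Finset ℂ) (h : ℝ) : Set ℂ := {w | ∀ ζ ∈ Z, 2 * h < ‖w - ζ‖}

lemma measurableSet_farFrom (Z : Finset ℂ) (h : ℝ) : MeasurableSet (farFrom Z h) := by
  have : farFrom Z h = ⋂ ζ ∈ Z, {w : ℂ | 2 * h < ‖w - ζ‖} := by ext; simp [farFrom]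
  rw [this]
  exact Finset.measurableSet_biInter _ fun ζ _ =>
    measurableSet_lt measurable_const (measurable_id.sub_const ζ).norm

lemma lt_norm_sub_of_mem_arcRegion {Z : Finset ℂ} {h : ℝ} {ζ z : ℂ} (hζ : ζ ∈ Z)
    (hζ1 : ‖ζ‖ = 1) (hz : z ∈ arcRegion (1 - h) (farFrom Z h)) : h < ‖z - ζ‖ := by
  have key : ‖z‖ < 1 - h → h < ‖z - ζ‖ := fun hz => by
    have := norm_sub_norm_le ζ z
    rw [norm_sub_rev, hζ1] at this
    linarith
  rcases hz with hz | ⟨hz1, hz⟩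
  · exact key hz
  · by_cases hr : ‖z‖ < 1 - h
    · exact key hr
    · have h1 := hz.2 ζ hζ
      have h2 : circPt z.arg - z = ((1 - ‖z‖ : ℝ) : ℂ) * circPt z.arg := by
        have := Complex.norm_mul_exp_arg_mul_I z
        rw [circPt]
        push_cast
        linear_combination this
      have h3 : ‖circPt z.arg - z‖ = 1 - ‖z‖ := by
        rw [h2, norm_smul_circPt, abs_of_nonneg (by linarith)]
      have h4 := norm_sub_le_norm_sub_add_norm_sub (circPt z.arg) z ζ
      linarith

lemma norm_mob_sub_le {ζ : ℂ} (hζ : ‖ζ‖ = 1) {h s a : ℝ} (hs : 0 < s) (hs1 : s ≤ 1)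
    (ha : a = 1 - s * h / 4) (ha0 : 0 ≤ a) (ha1 : a < 1) {w : ℂ}
    (hw : ‖w‖ ≤ 1) (hh : h < ‖w + 1‖) : ‖mob ζ a w - ζ‖ ≤ s := by
  have hne := one_add_mul_ne_zero ha0 ha1 hw
  have h1 : mob ζ a w - ζ = ζ * (((1 - a : ℝ) : ℂ) * (w - 1) / (1 + a * w)) := by
    rw [mob]
    have : (w + a) / (1 + a * w) - 1 = ((1 - a : ℝ) : ℂ) * (w - 1) / (1 + a * w) := by
      rw [div_sub_one hne]; push_cast; ring
    rw [← this]; ring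
  rw [h1, norm_mul, hζ, one_mul, norm_div, norm_mul, Complex.norm_real,
    Real.norm_of_nonneg (by linarith), div_le_iff₀ (norm_pos_iff.2 hne)]
  have h2 : ‖w - 1‖ ≤ 2 := (norm_sub_le _ _).trans (by rw [norm_one]; linarith)
  have h3 : ‖w + 1‖ ≤ ‖1 + (a : ℂ) * w‖ + (1 - a) := by
    have : w + 1 = (1 + (a : ℂ) * w) + ((1 - a : ℝ) : ℂ) * w := by push_cast; ring
    rw [this]
    refine (norm_add_le _ _).trans ?_
    rw [norm_mul, Complex.norm_real, Real.norm_of_nonneg (by linarith)]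
    nlinarith
  have hsh : 0 < s * h := by linarith
  have hh0 : 0 < h := pos_of_mul_pos_right hsh hs.le
  have h4 : s * h ≤ h := by nlinarith
  have h5 : (1 - a) * ‖w - 1‖ ≤ s * h / 4 * 2 := by
    rw [ha]; nlinarith
  nlinarith

lemma exists_pos_forall_le_dist (Z : Finset ℂ) :
    ∃ δ > 0, ∀ x ∈ Z, ∀ y ∈ Z, x ≠ y → δ ≤ dist x y := by
  classical
  set T := (Z ×ˢ Z).filter (fun p => p.1 ≠ p.2) with hT
  obtain ⟨δ, h0, h⟩ : ∃ δ > 0, ∀ p ∈ T, δ ≤ dist p.1 p.2 := by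
    by_cases hne : T.Nonempty
    · obtain ⟨p, hp, hmin⟩ := T.exists_min_image (fun p => dist p.1 p.2) hne
      exact ⟨dist p.1 p.2, dist_pos.2 (Finset.mem_filter.1 hp).2, hmin⟩
    · exact ⟨1, one_pos, fun p hp => absurd ⟨p, hp⟩ hne⟩
  exact ⟨δ, h0, fun x hx y hy hxy => h (x, y) (by simp [hT, hx, hy, hxy])⟩

lemma volume_arcs_mul {u : ℂ} (hu : ‖u‖ = 1) {B : Set ℂ} (hB : MeasurableSet B) :
    volume (arcs ((fun z => u * z) ⁻¹' B)) = volume (arcs B) := by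
  obtain ⟨c, hc0, hct, hc⟩ := exists_lintegral_circle_eq
  have key : ∀ {B : Set ℂ}, MeasurableSet B →
      ∫⁻ z in sphere (0 : ℂ) 1, B.indicator 1 z ∂μH[1] = c * volume (arcs B) := fun {B} hB => by
    rw [hc _ (measurable_one.indicator hB)]
    congr 1
    have : ∀ θ, B.indicator (1 : ℂ → ℝ≥0∞) (circPt θ) = (circPt ⁻¹' B).indicator 1 θ :=
      fun θ => rfl
    simp only [this]
    rw [lintegral_indicator_one (continuous_circPt.measurable hB),
      Measure.restrict_apply (continuous_circPt.measurable hB), inter_comm]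
    rfl
  have h := lintegral_circle_mul hu (B.indicator 1)
  have h2 : ∀ z, B.indicator (1 : ℂ → ℝ≥0∞) (u * z) =
    ((fun z => u * z) ⁻¹' B).indicator 1 z := fun z => rfl
  simp only [h2] at h
  rw [key hB, key (measurable_const_mul u hB)] at h
  exact ((ENNReal.mul_right_inj hc0 hct).1 h).symm

lemma volume_arcs_near_one_le {h : ℝ} :
    volume (arcs {w | ‖w - 1‖ ≤ 2 * h}) ≤ ENNReal.ofReal (2 * Real.pi * h) := by
  have hpi := Real.pi_pos
  have hsub : arcs {w | ‖w - 1‖ ≤ 2 * h} ⊆ Icc (-(Real.pi * h)) (Real.pi * h) := by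
    rintro θ ⟨hθ, hn⟩
    have h1 : ‖circPt θ - 1‖ = 2 * |Real.sin (θ / 2)| := by
      rw [circPt, mul_comm, Complex.norm_exp_I_mul_ofReal_sub_one, norm_mul, Real.norm_eq_abs,
        Real.norm_eq_abs, abs_two]
    have h2 : 2 / Real.pi * |θ / 2| ≤ |Real.sin (θ / 2)| :=
      Real.mul_abs_le_abs_sin (by
        rw [abs_div, abs_two]
        have := abs_le.2 ⟨hθ.1.le, hθ.2.le⟩
        linarith)
    rw [mem_ofPred_eq, h1] at hn
    rw [abs_div, abs_two] at h2
    have h3 : |θ| ≤ Real.pi * h := by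
      have : |θ| / Real.pi ≤ h := by
        calc |θ| / Real.pi = 2 / Real.pi * (|θ| / 2) := by ring
          _ ≤ h := by linarith
      rwa [div_le_iff₀ hpi, mul_comm] at this
    exact abs_le.1 h3
  refine (measure_mono hsub).trans ?_
  rw [Real.volume_Icc]
  exact ENNReal.ofReal_le_ofReal (by linarith)

lemma le_volume_arcs_farFrom {Z : Finset ℂ} (hZ : ∀ ζ ∈ Z, ‖ζ‖ = 1) {h : ℝ} (h0 : 0 ≤ h) :
    ENNReal.ofReal (2 * Real.pi * (1 - Z.card * h)) ≤ volume (arcs (farFrom Z h)) := by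
  have hpi := Real.pi_pos
  have hbad : ∀ ζ ∈ Z, volume (arcs {w | ‖w - ζ‖ ≤ 2 * h}) ≤ ENNReal.ofReal (2 * Real.pi * h) := by
    intro ζ hζ
    have hm : MeasurableSet {w : ℂ | ‖w - ζ‖ ≤ 2 * h} :=
      measurableSet_le (measurable_id.sub_const ζ).norm measurable_const
    have he : (fun z => ζ * z) ⁻¹' {w | ‖w - ζ‖ ≤ 2 * h} = {w | ‖w - 1‖ ≤ 2 * h} := by
      ext z
      have : ζ * z - ζ = ζ * (z - 1) := by ring
      simp only [mem_preimage, mem_ofPred_eq, this, norm_mul, hZ ζ hζ, one_mul]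
    rw [← volume_arcs_mul (hZ ζ hζ) hm, he]
    exact volume_arcs_near_one_le
  have hcov : Ioo (-Real.pi) Real.pi ⊆
      arcs (farFrom Z h) ∪ ⋃ ζ ∈ Z, arcs {w | ‖w - ζ‖ ≤ 2 * h} := fun θ hθ => by
    by_cases hf : circPt θ ∈ farFrom Z h
    · exact Or.inl ⟨hθ, hf⟩
    · right
      simp only [farFrom, mem_ofPred_eq, not_forall, not_lt] at hf
      obtain ⟨ζ, hζ, hle⟩ := hf
      exact mem_biUnion hζ ⟨hθ, hle⟩
  have h1 : ENNReal.ofReal (2 * Real.pi) ≤ volume (arcs (farFrom Z h)) +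
      ENNReal.ofReal (2 * Real.pi * (Z.card * h)) := by
    calc ENNReal.ofReal (2 * Real.pi) = volume (Ioo (-Real.pi) Real.pi) := by
          rw [Real.volume_Ioo]; congr 1; ring
      _ ≤ volume (arcs (farFrom Z h)) + ∑ ζ ∈ Z, volume (arcs {w | ‖w - ζ‖ ≤ 2 * h}) :=
          (measure_mono hcov).trans ((measure_union_le _ _).trans
            (add_le_add_right (measure_biUnion_finset_le _ _) _))
      _ ≤ volume (arcs (farFrom Z h)) + ∑ _ζ ∈ Z, ENNReal.ofReal (2 * Real.pi * h) := by
          gcongr with ζ hζ; exact hbad ζ hζ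
      _ = _ := by
          rw [Finset.sum_const, nsmul_eq_mul, ← ENNReal.ofReal_natCast,
            ← ENNReal.ofReal_mul (by positivity)]
          congr 2; ring
  have h2 : 2 * Real.pi * (1 - Z.card * h) = 2 * Real.pi - 2 * Real.pi * (Z.card * h) := by ring
  rw [h2, ENNReal.ofReal_sub _ (by positivity)]
  exact tsub_le_iff_right.2 h1


/-- The `q`-th roots of unity in the complex plane. -/
def unityRoots (q : ℕ) : Finset ℂ := Polynomial.nthRootsFinset q (1 : ℂ)

lemma mem_unityRoots {q : ℕ} (hq : 0 < q) {z : ℂ} : z ∈ unityRoots q ↔ z ^ q = 1 :=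
  Polynomial.mem_nthRootsFinset hq _

lemma norm_of_mem_unityRoots {q : ℕ} (hq : 0 < q) {z : ℂ} (hz : z ∈ unityRoots q) : ‖z‖ = 1 :=
  Complex.norm_eq_one_of_pow_eq_one ((mem_unityRoots hq).1 hz) hq.ne'

lemma card_unityRoots {q : ℕ} (hq : 0 < q) : (unityRoots q).card = q :=
  (Complex.isPrimitiveRoot_exp q hq.ne').card_nthRootsFinset

/-- The images of the circle concentrating at the `q`-th roots of unity together with the circle
itself (if `m = 1`) form a system, invariant under the `q`-th roots of unity. -/
lemma exists_bubbleSystem {q m : ℕ} (hq : 0 < q) (hm : m ≤ 1) {h : ℝ} (h0 : 0 < h) (h1 : h < 1) :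
    ∃ S : BubbleSystem ({z // z ∈ unityRoots q} ⊕ Fin m), S.r = 1 - h ∧
      ENNReal.ofReal (2 * Real.pi * (q * (1 - h) + m * (1 - q * h))) ≤
        ∑ i, volume (arcs (S.B i)) ∧
      ∀ u ∈ unityRoots q, ∀ z, S.weight (u * z) = S.weight z := by
  have hpi := Real.pi_pos
  obtain ⟨δ, hδ, hsep⟩ := exists_pos_forall_le_dist (unityRoots q)
  obtain ⟨s, hs0, hsh, hsδ⟩ : ∃ s > 0, s < h ∧ 2 * s < δ := by
    refine ⟨min h δ / 3, by positivity, ?_, ?_⟩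
    · linarith [min_le_left h δ]
    · linarith [min_le_right h δ]
  obtain ⟨a, ha⟩ : ∃ a : ℝ, a = 1 - s * h / 4 := ⟨_, rfl⟩
  have ha1 : a < 1 := by have := mul_pos hs0 h0; linarith
  have ha0 : 0 ≤ a := by nlinarith
  have hroot : ∀ z ∈ unityRoots q, ‖z‖ = 1 := fun z hz => norm_of_mem_unityRoots hq hz
  have hr : 1 - h < 1 := by linarith
  have hper : ∀ ζ ∈ unityRoots q, ∀ z ∈ mob ζ a '' arcRegion (1 - h) (farFrom {-1} h),
      ‖z - ζ‖ ≤ s := by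
    rintro ζ hζ _ ⟨w, hw, rfl⟩
    have hw1 : ‖w‖ ≤ 1 := by simpa using (ball_subset_closedBall (arcRegion_subset hr _ hw))
    refine norm_mob_sub_le (hroot ζ hζ) hs0 (hsh.trans h1).le ha ha0 ha1 hw1 ?_
    simpa using lt_norm_sub_of_mem_arcRegion (Finset.mem_singleton_self (-1 : ℂ)) (by simp) hw
  have hcen : ∀ ζ ∈ unityRoots q, ∀ z ∈ mob 1 0 '' arcRegion (1 - h) (farFrom (unityRoots q) h),
      h < ‖z - ζ‖ := by
    rintro ζ hζ _ ⟨w, hw, rfl⟩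
    have : mob 1 0 w = w := by simp [mob]
    rw [this]
    exact lt_norm_sub_of_mem_arcRegion hζ (hroot ζ hζ) hw
  let S : BubbleSystem ({z // z ∈ unityRoots q} ⊕ Fin m) :=
    { ζ := Sum.elim (fun z => z.1) fun _ => 1
      a := Sum.elim (fun _ => a) fun _ => 0
      B := Sum.elim (fun _ => farFrom {-1} h) fun _ => farFrom (unityRoots q) h
      r := 1 - h
      norm_ζ := by
        rintro (i | i)
        · exact hroot i.1 i.2
        · simp
      a_nonneg := by rintro (i | i) <;> simp [ha0]
      a_lt := by rintro (i | i) <;> simp [ha1]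
      measurableSet_B := by rintro (i | i) <;> exact measurableSet_farFrom _ _
      r_pos := by linarith
      r_lt := hr
      disjoint := by
        rintro (i | i) (j | j) hij
        · refine Set.disjoint_left.2 fun z hz hz' => ?_
          have e1 := hper i.1 i.2 z hz
          have e2 := hper j.1 j.2 z hz'
          have e3 := hsep i.1 i.2 j.1 j.2 fun e => hij (by rw [Subtype.ext e])
          have e4 := dist_triangle_left i.1 j.1 z
          rw [dist_eq_norm z, dist_eq_norm z] at e4
          linarith
        · refine Set.disjoint_left.2 fun z hz hz' => ?_
          have e1 := hper i.1 i.2 z hz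
          have e2 := hcen i.1 i.2 z hz'
          linarith
        · refine Set.disjoint_left.2 fun z hz hz' => ?_
          have e1 := hper j.1 j.2 z hz'
          have e2 := hcen j.1 j.2 z hz
          linarith
        · refine absurd (congrArg Sum.inr (Fin.ext ?_)) hij
          omega }
  refine ⟨S, rfl, ?_, ?_⟩
  · have hq1 := le_volume_arcs_farFrom (Z := {-1}) (by simp) h0.le
    have hq2 := le_volume_arcs_farFrom hroot h0.le
    rw [card_unityRoots hq] at hq2
    rw [Finset.card_singleton, Nat.cast_one, one_mul] at hq1
    rw [Fintype.sum_sum_type]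
    have e1 : ∀ i : {z // z ∈ unityRoots q}, S.B (Sum.inl i) = farFrom {-1} h := fun _ => rfl
    have e2 : ∀ i : Fin m, S.B (Sum.inr i) = farFrom (unityRoots q) h := fun _ => rfl
    simp only [e1, e2, Finset.sum_const, Finset.card_univ, Fintype.card_coe, card_unityRoots hq,
      Fintype.card_fin, nsmul_eq_mul]
    have e3 : 2 * Real.pi * (q * (1 - h) + m * (1 - q * h)) =
        q * (2 * Real.pi * (1 - h)) + m * (2 * Real.pi * (1 - q * h)) := by ring
    rw [e3]
    refine ENNReal.ofReal_add_le.trans ?_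
    rw [ENNReal.ofReal_mul (Nat.cast_nonneg _), ENNReal.ofReal_mul (Nat.cast_nonneg _),
      ENNReal.ofReal_natCast, ENNReal.ofReal_natCast]
    gcongr
  · intro u hu z
    have hu1 := (mem_unityRoots hq).1 hu
    have hu0 : u ≠ 0 := by rintro rfl; simp [hq.ne'] at hu1
    simp only [BubbleSystem.weight, Fintype.sum_sum_type, bubble_mul]
    congr 1
    · let e : {z // z ∈ unityRoots q} ≃ {z // z ∈ unityRoots q} :=
        (Equiv.mulLeft₀ u⁻¹ (inv_ne_zero hu0)).subtypeEquiv fun x => by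
          rw [mem_unityRoots hq, mem_unityRoots hq]
          simp [mul_pow, hu1]
      exact e.sum_comp fun x => bubble x.1 a (farFrom {-1} h) z
    · refine Finset.sum_congr rfl fun i _ => ?_
      change bubble (u⁻¹ * 1) 0 (farFrom (unityRoots q) h) z =
        bubble 1 0 (farFrom (unityRoots q) h) z
      rw [← bubble_mul]
      have e1 : ∀ w, mobInv 1 0 w = w := fun w => by simp [mobInv]
      have hfar : u * z ∈ farFrom (unityRoots q) h ↔ z ∈ farFrom (unityRoots q) h := by
        have hn : ∀ ζ, ‖u * z - u * ζ‖ = ‖z - ζ‖ := fun ζ => by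
          rw [← mul_sub, norm_mul, hroot u hu, one_mul]
        constructor
        · intro H ζ hζ
          rw [← hn]
          exact H _ ((mem_unityRoots hq).2 (by
            rw [mul_pow, hu1, one_mul]; exact (mem_unityRoots hq).1 hζ))
        · intro H ζ hζ
          have := H (u⁻¹ * ζ) ((mem_unityRoots hq).2 (by
            rw [mul_pow, inv_pow, hu1, (mem_unityRoots hq).1 hζ]; simp))
          rwa [← hn, mul_inv_cancel_left₀ hu0] at this
      by_cases hz : z ∈ farFrom (unityRoots q) h
      · rw [bubble, bubble, if_pos (by rwa [e1, hfar]), if_pos (by rwa [e1])]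
        simp
      · rw [bubble, bubble, if_neg (by rwa [e1, hfar]), if_neg (by rwa [e1])]

/-! ### The disk as a member of the symmetric class -/

lemma exists_lipschitzWith_eqOn_neg_sqrt :
    ∃ (K : ℝ≥0) (φ : ℝ → ℝ), LipschitzWith K φ ∧
      EqOn φ (fun t => -√(1 - t ^ 2)) (Icc (-(1 / 2)) (1 / 2)) := by
  have hd : ContDiffOn ℝ 1 (fun t : ℝ => -√(1 - t ^ 2)) (Icc (-(1 / 2)) (1 / 2)) := by
    refine (ContDiffOn.sqrt (by fun_prop) fun t ht => ?_).neg
    nlinarith [ht.1, ht.2]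
  obtain ⟨K, hK⟩ := hd.exists_lipschitzOnWith (by simp) (convex_Icc _ _) isCompact_Icc
  obtain ⟨φ, hφ, heq⟩ := hK.extend_real
  exact ⟨K, φ, hφ, heq.symm⟩

lemma isLipschitzDomain_ball : IsLipschitzDomain (ball (0 : E2) 1) := by
  refine ⟨isOpen_ball, (convex_ball (0 : E2) 1).isConnected ⟨0, by simp⟩, isBounded_ball,
    fun p hp => ?_⟩
  rw [frontier_ball_E2] at hp
  have hn : ∀ x : E2, ‖x‖ ^ 2 = x 0 ^ 2 + x 1 ^ 2 := fun x => by
    rw [EuclideanSpace.norm_sq_eq, Fin.sum_univ_two]; simp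
  obtain ⟨w, rfl⟩ := toE2.surjective p
  have hw : ‖w‖ = 1 := by simpa using hp
  let c : Circle := ⟨-Complex.I * (starRingEnd ℂ) w, by simp [Submonoid.unitSphere, hw]⟩
  let e : E2 ≃ₗᵢ[ℝ] E2 := toE2.symm.trans ((rotation c).trans toE2)
  have he : e (toE2 w) = toE2 (-Complex.I) := by
    change toE2 (rotation c (toE2.symm (toE2 w))) = _
    rw [LinearIsometryEquiv.symm_apply_apply, rotation_apply]
    change toE2 (-Complex.I * (starRingEnd ℂ) w * w) = _
    rw [mul_assoc, mul_comm _ w, Complex.mul_conj, Complex.normSq_eq_norm_sq, hw]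
    simp
  obtain ⟨K, φ, hφ, heq⟩ := exists_lipschitzWith_eqOn_neg_sqrt
  have hc : ∀ i, Continuous fun x => e x i := fun i =>
    (EuclideanSpace.proj (𝕜 := ℝ) i).continuous.comp e.continuous
  refine ⟨e, K, φ, {x | |e x 0| < 1 / 2} ∩ {x | e x 1 < 0}, hφ,
    (isOpen_lt (hc 0).abs continuous_const).inter (isOpen_lt (hc 1) continuous_const), ?_, ?_⟩
  · simp [he, toE2_apply_zero, toE2_apply_one]
  · rintro x ⟨hx0, hx1⟩
    rw [mem_ofPred_eq] at hx0 hx1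
    have h2 : ‖e x‖ ^ 2 = e x 0 ^ 2 + e x 1 ^ 2 := hn _
    rw [heq ⟨(abs_lt.1 hx0).1.le, (abs_lt.1 hx0).2.le⟩, mem_ball_zero_iff, ← e.norm_map,
      ← abs_of_nonneg (norm_nonneg (e x)), ← sq_lt_one_iff_abs_lt_one, h2]
    change _ ↔ -√(1 - e x 0 ^ 2) < e x 1
    rw [neg_lt, Real.lt_sqrt (by linarith)]
    constructor <;> intro h <;> nlinarith

lemma simplyConnectedSpace_ball : SimplyConnectedSpace (ball (0 : E2) 1) := by
  have : ContractibleSpace (ball (0 : E2) 1) :=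
    (convex_ball (0 : E2) 1).contractibleSpace ⟨0, by simp⟩
  infer_instance

lemma rotBy_image_ball (θ : ℝ) : rotBy θ '' ball (0 : E2) 1 = ball 0 1 := by
  have hn : ∀ (θ : ℝ) (z : ℂ), ‖rotBy θ (toE2 z)‖ = ‖z‖ := fun θ z => by
    rw [rotBy_toE2, LinearIsometryEquiv.norm_map, norm_mul, norm_circPt, one_mul]
  ext x
  obtain ⟨z, rfl⟩ := toE2.surjective x
  simp only [mem_image, mem_ball, dist_zero_right]
  constructor
  · rintro ⟨y, hy, h⟩
    obtain ⟨w, rfl⟩ := toE2.surjective y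
    rw [← h, hn]
    simpa using hy
  · intro h
    refine ⟨toE2 (circPt (-θ) * z), by simpa [norm_circPt] using h, ?_⟩
    rw [rotBy_toE2, ← mul_assoc, circPt, circPt, ← Complex.exp_add]
    simp

lemma memDp_ball {ι : Type*} [Fintype ι] (S : BubbleSystem ι) {p : ℕ}
    (hpos : ∑ i, volume (arcs (S.B i)) ≠ 0)
    (hinv : ∀ z, S.weight (circPt (2 * Real.pi / p) * z) = S.weight z) :
    MemDp p (ball 0 1) S.weightE2 := by
  have hm : Measurable S.weightE2 :=
    S.measurable_weight.comp toE2.symm.continuous.measurable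
  refine ⟨isLipschitzDomain_ball, simplyConnectedSpace_ball, rotBy_image_ball _,
    fun x => S.weight_nonneg _, ⟨∑ i, 4 / (1 - S.a i ^ 2), ?_⟩, ?_, ?_⟩
  · rw [frontier_ball_E2]
    refine (ae_restrict_mem isClosed_sphere.measurableSet).mono fun x hx => S.weight_le ?_
    rw [LinearIsometryEquiv.norm_map]
    simpa using hx
  · rw [pos_iff_ne_zero]
    intro h0
    obtain ⟨c, hc0, hct, hc⟩ := exists_lintegral_circle_eq
    have h1 := S.lintegral_weight hc (G := fun _ => 1) measurable_const
    have h2 := lintegral_sphere_E2 fun x => ENNReal.ofReal (S.weightE2 x)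
    have h3 : ∫⁻ x in sphere (0 : E2) 1, ENNReal.ofReal (S.weightE2 x) ∂μH[1] = 0 := by
      rw [lintegral_eq_zero_iff hm.ennreal_ofReal, EventuallyEq, ae_restrict_iff' isClosed_sphere.measurableSet,
        ae_iff]
      refine measure_mono_null (fun x hx => ?_) h0
      simp only [mem_ofPred_eq, not_forall, Pi.zero_apply, ENNReal.ofReal_eq_zero, not_le] at hx
      obtain ⟨h, h'⟩ := hx
      exact ⟨by rwa [frontier_ball_E2], h'⟩
    rw [h2] at h3
    simp only [BubbleSystem.weightE2, LinearIsometryEquiv.symm_apply_apply] at h3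
    simp only [mul_one, h3, setLIntegral_one] at h1
    rcases mul_eq_zero.1 h1.symm with h | h
    · exact hc0 h
    · exact hpos h
  · intro x _
    obtain ⟨z, rfl⟩ := toE2.surjective x
    rw [rotBy_toE2, BubbleSystem.weightE2, BubbleSystem.weightE2,
      LinearIsometryEquiv.symm_apply_apply, LinearIsometryEquiv.symm_apply_apply, hinv]


/-! ### The disk is not a maximiser -/

lemma nat_sub_one_lt_of_eq {q m : ℕ} (hm : m ≤ 1) {h : ℝ} (hh : h = 1 / (4 * (q + 1))) :
    (q + m : ℝ) - 1 < (1 - h) * (q * (1 - h) + m * (1 - q * h)) := by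
  have hq : (0 : ℝ) ≤ q := Nat.cast_nonneg _
  have hm' : (m : ℝ) ≤ 1 := by exact_mod_cast hm
  have hm0 : (0 : ℝ) ≤ m := Nat.cast_nonneg _
  have h0 : 0 < h := by rw [hh]; positivity
  have e : 4 * (q * h) + 4 * h = 1 := by rw [hh]; field_simp
  have hqh : 0 ≤ q * h := by positivity
  have h1 : (m : ℝ) * (q * h) ≤ q * h := mul_le_of_le_one_left hqh hm'
  have h2 : (m : ℝ) * h ≤ h := mul_le_of_le_one_left h0.le hm'
  have h3 : 0 ≤ h * (q * h + m * (q * h)) := by positivity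
  nlinarith

lemma not_mem_KSet {p q m k : ℕ} (hp : p ≠ 0) (hpq : p ∣ q) (hq : 0 < q) (hm : m ≤ 1)
    (hk : q + m ≤ k) (hk' : (k + 1) / 2 + 1 ≤ q + m) : k ∉ KSet p := by
  rintro ⟨-, hsup⟩
  have hpi := Real.pi_pos
  obtain ⟨h, hh⟩ : ∃ h : ℝ, h = 1 / (4 * (q + 1)) := ⟨_, rfl⟩
  have hq' : (0 : ℝ) < q := by exact_mod_cast hq
  have h0 : 0 < h := by rw [hh]; positivity
  have h1 : h < 1 := by rw [hh, div_lt_one (by positivity)]; linarith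
  obtain ⟨S, hr, hvol, hinv⟩ := exists_bubbleSystem hq hm h0 h1
  have hmain := nat_sub_one_lt_of_eq hm hh
  have hkr : (((k + 1) / 2 : ℕ) : ℝ) ≤ q + m - 1 := by
    have : (((k + 1) / 2 + 1 : ℕ) : ℝ) ≤ (q + m : ℕ) := by exact_mod_cast hk'
    push_cast at this ⊢
    linarith
  have hpos : 0 < (1 - h) * (q * (1 - h) + m * (1 - q * h)) :=
    (Nat.cast_nonneg _).trans_lt (hkr.trans_lt hmain)
  have hpos' : 0 < (q * (1 - h) + m * (1 - q * h) : ℝ) :=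
    (mul_pos_iff_of_pos_left (by linarith)).1 hpos
  have : Nonempty ({z // z ∈ unityRoots q} ⊕ Fin m) :=
    ⟨Sum.inl ⟨1, (mem_unityRoots hq).2 (one_pow q)⟩⟩
  have hcirc : circPt (2 * Real.pi / p) ∈ unityRoots q := by
    rw [mem_unityRoots hq]
    obtain ⟨n, rfl⟩ := hpq
    have : circPt (2 * Real.pi / p) ^ p = 1 := by
      rw [circPt, ← Complex.exp_nat_mul, ← Complex.exp_two_pi_mul_I]
      congr 1
      push_cast
      field_simp
    rw [pow_mul, this, one_pow]
  have hmem : MemDp p (ball 0 1) S.weightE2 :=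
    memDp_ball S (fun h => by
      rw [h, nonpos_iff_eq_zero, ENNReal.ofReal_eq_zero] at hvol
      nlinarith) (hinv _ hcirc)
  have hcard : Fintype.card ({z // z ∈ unityRoots q} ⊕ Fin m) ≤ k := by
    rwa [Fintype.card_sum, Fintype.card_coe, card_unityRoots hq, Fintype.card_fin]
  have hge : steklovW (ball 0 1) S.weightE2 k * Lweight (ball 0 1) S.weightE2 ≤ SigmaP p k :=
    le_iSup_of_le (ball 0 1) (le_iSup_of_le S.weightE2 (le_iSup_of_le hmem le_rfl))
  have hlow := (mul_le_mul_right hvol (ENNReal.ofReal S.r)).trans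
    ((S.steklovW_mul_Lweight_ge hcard).trans hge)
  rw [hsup, hr, ← ENNReal.ofReal_mul (by linarith), ENNReal.ofReal_le_ofReal_iff (by positivity)]
    at hlow
  have := hkr.trans_lt hmain
  nlinarith [mul_lt_mul_of_pos_left this (mul_pos two_pos hpi)]

/-- No index `k ≥ p` belongs to `KSet p`. -/
lemma not_mem_KSet_of_le {p k : ℕ} (hp : 2 ≤ p) (hk : p ≤ k) : k ∉ KSet p := by
  rcases hk.eq_or_lt with rfl | hk
  · exact not_mem_KSet (m := 0) (by omega) dvd_rfl (by omega) (by omega) le_rfl (by omega)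
  · obtain ⟨n, hn⟩ : ∃ n, n = (k - 1) / p := ⟨_, rfl⟩
    have h1 : p * n ≤ k - 1 := by rw [hn]; exact Nat.mul_div_le _ _
    have h2 : k - 1 < p * n + p := by
      rw [hn]; exact Nat.lt_mul_div_succ _ (by omega)
    have h3 : 1 ≤ n := by rw [hn]; exact (Nat.one_le_div_iff (by omega)).2 (by omega)
    have h4 : p ≤ p * n := Nat.le_mul_of_pos_right _ h3
    exact not_mem_KSet (q := p * n) (m := 1) (by omega) (dvd_mul_right _ _) (by omega) le_rfl
      (by omega) (by omega)

theorem statement11 (p : ℕ) (hp : 2 ≤ p) :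
    (Even p → p ∉ KSet p)
    ∧ (p ≤ 6 → ∀ k : ℕ, p + 1 ≤ k → k ∉ KSet p)
    ∧ (Odd p → ∀ k : ℕ, 2 * p ≤ k → k ∉ KSet p)
    ∧ (Even p → ∀ k : ℕ, 2 * p ≤ k → k ∈ KSet p → k = 3 * p - 1) :=
  ⟨fun _ => not_mem_KSet_of_le hp le_rfl,
    fun _ _ hk => not_mem_KSet_of_le hp (by omega),
    fun _ _ hk => not_mem_KSet_of_le hp (by omega),
    fun _ _ hk h => absurd h (not_mem_KSet_of_le hp (by omega))⟩

end
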